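/- Let d ≥ 3 and 1 ≤ p ≤ 2, with p' the conjugate exponent of p. Then there exists a constant C > 0 such that for every integer n ≥ 1 and every f ∈ L²(S^{d-1}, σ), ‖T_n f‖_{p'} ≤ C · n^{(d−2)(1/p − 1/2)} · ‖f‖_p. -/

import Mathlib

open MeasureTheory Metric
open scoped ENNReal

noncomputable section

/-- The unit sphere `S^{d-1}` in `ℝ^d`. -/
abbrev Sph (d : ℕ) := Metric.sphere (0 : EuclideanSpace ℝ (Fin d)) 1

/-- The surface measure `σ` on the unit sphere in `ℝ^d`. -/
def sphMeasure (d : ℕ) : Measure (Sph d) :=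
  (volume : Measure (EuclideanSpace ℝ (Fin d))).toSphere

/-- `Y : S^{d-1} → ℝ` is a spherical harmonic of degree `n` if it is the restriction to
`S^{d-1}` of a polynomial in `d` real variables that is homogeneous of degree `n` and
harmonic (the sum of its second partial derivatives vanishes identically). -/
def IsSphericalHarmonic (d n : ℕ) (Y : Sph d → ℝ) : Prop :=
  ∃ P : MvPolynomial (Fin d) ℝ, P.IsHomogeneous n ∧
    (∑ i : Fin d, MvPolynomial.pderiv i (MvPolynomial.pderiv i P)) = 0 ∧
    ∀ x : Sph d, Y x = MvPolynomial.eval (fun i => (x : EuclideanSpace ℝ (Fin d)) i) P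

/-- `H_k^d`: the subspace of `L²(S^{d-1}, σ)` consisting of (equivalence classes of)
spherical harmonics of degree `k`. -/
def Hspace (d k : ℕ) : Submodule ℝ (Lp ℝ 2 (sphMeasure d)) :=
  Submodule.span ℝ {f : Lp ℝ 2 (sphMeasure d) |
    ∃ Y : Sph d → ℝ, IsSphericalHarmonic d k Y ∧ ⇑f =ᵐ[sphMeasure d] Y}

/-- `T` is the orthogonal projection of `L²(S^{d-1}, σ)` onto `H_k^d`: it maps into
`H_k^d` and `f - T f` is orthogonal to `H_k^d` for every `f`. -/
def IsOrthProjOnto (d k : ℕ)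
    (T : Lp ℝ 2 (sphMeasure d) → Lp ℝ 2 (sphMeasure d)) : Prop :=
  ∀ f : Lp ℝ 2 (sphMeasure d), T f ∈ Hspace d k ∧
    ∀ g ∈ Hspace d k, @inner ℝ _ _ (f - T f) g = 0

/-- The constant `c_n = (Γ(d/2)/(2π^{d/2})) ((d+2n-2)/(d+n-2)) Γ(d+n-1)/(Γ(n+1)Γ(d-1))`. -/
def cCoef (d n : ℕ) : ℝ :=
  Real.Gamma ((d : ℝ) / 2) / (2 * Real.pi ^ ((d : ℝ) / 2)) *
    (((d : ℝ) + 2 * (n : ℝ) - 2) / ((d : ℝ) + (n : ℝ) - 2)) *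
    (Real.Gamma ((d : ℝ) + (n : ℝ) - 1) /
      (Real.Gamma ((n : ℝ) + 1) * Real.Gamma ((d : ℝ) - 1)))

/-- The operator `T_n f = ∑_{j=0}^{d-2} (-1)^j binom(d-2, j) (c_n / c_{n+2j}) proj_{n+2j} f`
on `L²(S^{d-1}, σ)`, built from the orthogonal projections `proj_k` onto `H_k^d`. -/
def Tconv (d : ℕ) (proj : ℕ → Lp ℝ 2 (sphMeasure d) → Lp ℝ 2 (sphMeasure d)) (n : ℕ)
    (f : Lp ℝ 2 (sphMeasure d)) : Lp ℝ 2 (sphMeasure d) :=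
  ∑ j ∈ Finset.range (d - 1),
    ((-1 : ℝ) ^ j * ((d - 2).choose j : ℝ) * (cCoef d n / cCoef d (n + 2 * j))) •
      proj (n + 2 * j) f

open MvPolynomial in
/-- The Laplacian of a polynomial in `d` variables. -/
def polyLaplacian {d : ℕ} (P : MvPolynomial (Fin d) ℝ) : MvPolynomial (Fin d) ℝ :=
  ∑ i : Fin d, pderiv i (pderiv i P)

/-- The integral of a polynomial over the unit sphere. -/
def sphIntegral {d : ℕ} (P : MvPolynomial (Fin d) ℝ) : ℝ :=
  ∫ x : Sph d, MvPolynomial.eval (fun i => (x : EuclideanSpace ℝ (Fin d)) i) P ∂sphMeasure d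

instance instIsFiniteMeasureSphMeasure (d : ℕ) : IsFiniteMeasure (sphMeasure d) := by
  unfold sphMeasure; infer_instance

lemma continuous_eval_euclidean {d : ℕ} (P : MvPolynomial (Fin d) ℝ) :
    Continuous fun x : EuclideanSpace ℝ (Fin d) => MvPolynomial.eval (fun i => x i) P :=
  (MvPolynomial.continuous_eval P).comp (by fun_prop)

lemma continuous_eval_sph {d : ℕ} (P : MvPolynomial (Fin d) ℝ) :
    Continuous fun x : Sph d =>
      MvPolynomial.eval (fun i => (x : EuclideanSpace ℝ (Fin d)) i) P :=
  (continuous_eval_euclidean P).comp continuous_subtype_val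

lemma integrable_of_continuous_sph {d : ℕ} {f : Sph d → ℝ} (hf : Continuous f) :
    Integrable f (sphMeasure d) :=
  hf.integrable_of_hasCompactSupport (HasCompactSupport.of_compactSpace f)

open MvPolynomial in
lemma hasFDerivAt_eval_euclidean {d : ℕ} (P : MvPolynomial (Fin d) ℝ)
    (x : EuclideanSpace ℝ (Fin d)) :
    HasFDerivAt (fun x : EuclideanSpace ℝ (Fin d) => eval (fun i => x i) P)
      (∑ i, eval (fun i => x i) (pderiv i P) •
        (EuclideanSpace.proj i : EuclideanSpace ℝ (Fin d) →L[ℝ] ℝ)) x := by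
  induction P using MvPolynomial.induction_on with
  | C a => simpa using hasFDerivAt_const a x
  | add p q hp hq =>
    refine ((hp.add hq).congr_fderiv ?_).congr_of_eventuallyEq (.of_forall fun y => ?_)
    · simp [add_smul, Finset.sum_add_distrib]
    · simp
  | mul_X p i hp =>
    have h := hp.mul (EuclideanSpace.proj i : EuclideanSpace ℝ (Fin d) →L[ℝ] ℝ).hasFDerivAt (x := x)
    simp only [map_mul, eval_X, Derivation.leibniz, pderiv_X, smul_eq_mul, map_add]
    refine (h.congr_fderiv ?_)
    ext v
    simp [add_mul, Finset.sum_add_distrib, Finset.mul_sum, Pi.single_apply, mul_assoc,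
      apply_ite (eval fun i => x i)]

lemma norm_eval_euclidean_le {d : ℕ} {k : ℕ} {P : MvPolynomial (Fin d) ℝ} (hP : P.IsHomogeneous k)
    (x : EuclideanSpace ℝ (Fin d)) :
    ‖MvPolynomial.eval (fun i => x i) P‖ ≤ (∑ s ∈ P.support, ‖P.coeff s‖) * ‖x‖ ^ k := by
  rw [MvPolynomial.eval_eq', Finset.sum_mul]
  refine (norm_sum_le _ _).trans (Finset.sum_le_sum fun s hs => ?_)
  rw [norm_mul, norm_prod]
  gcongr
  have hk : ∑ i, s i = k := by
    have := hP (MvPolynomial.mem_support_iff.1 hs)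
    simpa [Finsupp.weight_apply, Finsupp.sum_fintype] using this
  calc ∏ i, ‖x i ^ s i‖ ≤ ∏ i, ‖x‖ ^ s i := by
        refine Finset.prod_le_prod (fun _ _ => norm_nonneg _) fun i _ => ?_
        rw [norm_pow]
        gcongr
        exact PiLp.norm_apply_le x i
    _ = ‖x‖ ^ k := by rw [Finset.prod_pow_eq_pow_sum, hk]

lemma integrable_norm_pow_mul_gaussian {d : ℕ} (hd : 1 ≤ d) (k : ℕ) :
    Integrable fun x : EuclideanSpace ℝ (Fin d) => ‖x‖ ^ k * Real.exp (-(1 / 2) * ‖x‖ ^ 2) := by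
  have : NeZero d := ⟨by omega⟩
  have h := integrable_fun_norm_addHaar (volume : Measure (EuclideanSpace ℝ (Fin d)))
    (f := fun r : ℝ => r ^ k * Real.exp (-(1 / 2) * r ^ 2))
  refine h.2 ?_
  have h2 := integrableOn_rpow_mul_exp_neg_mul_sq (b := 1 / 2) (by norm_num)
    (s := ((d - 1 + k : ℕ) : ℝ)) (by linarith [Nat.cast_nonneg (α := ℝ) (d - 1 + k)])
  refine h2.congr_fun (fun r _ => ?_) measurableSet_Ioi
  simp only [Real.rpow_natCast, finrank_euclideanSpace, Fintype.card_fin, smul_eq_mul]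
  ring

lemma integrable_eval_mul_gaussian {d : ℕ} (hd : 1 ≤ d) {k : ℕ} {P : MvPolynomial (Fin d) ℝ}
    (hP : P.IsHomogeneous k) :
    Integrable fun x : EuclideanSpace ℝ (Fin d) =>
      MvPolynomial.eval (fun i => x i) P * Real.exp (-(1 / 2) * ‖x‖ ^ 2) := by
  refine ((integrable_norm_pow_mul_gaussian hd k).const_mul
    (∑ s ∈ P.support, ‖P.coeff s‖)).mono' ?_ (.of_forall fun x => ?_)
  · exact ((continuous_eval_euclidean P).mul (by fun_prop)).aestronglyMeasurable
  · rw [norm_mul, Real.norm_of_nonneg (Real.exp_pos _).le, ← mul_assoc]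
    gcongr
    exact norm_eval_euclidean_le hP x

/-- The radial moments of the Gaussian weight. -/
def gaussianRadialMoment (d k : ℕ) : ℝ :=
  ∫ r in Set.Ioi (0 : ℝ), r ^ (d - 1) * (r ^ k * Real.exp (-(1 / 2) * r ^ 2))

lemma gaussianRadialMoment_eq {d : ℕ} (hd : 1 ≤ d) (k : ℕ) :
    gaussianRadialMoment d k =
      (1 / 2 : ℝ) ^ (-((d : ℝ) + k) / 2) * (1 / 2) * Real.Gamma (((d : ℝ) + k) / 2) := by
  have h := integral_rpow_mul_exp_neg_mul_rpow (p := 2) (q := (d : ℝ) + k - 1) (b := 1 / 2)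
    (by norm_num) (by
      have : (1 : ℝ) ≤ d := by exact_mod_cast hd
      linarith [Nat.cast_nonneg (α := ℝ) k]) (by norm_num)
  rw [sub_add_cancel] at h
  rw [← h, gaussianRadialMoment]
  refine setIntegral_congr_fun measurableSet_Ioi fun r _ => ?_
  have : (d : ℝ) + k - 1 = ((d - 1 + k : ℕ) : ℝ) := by
    push_cast [Nat.cast_sub hd]; ring
  simp only [this, Real.rpow_natCast, Real.rpow_two]
  ring

lemma gaussianRadialMoment_pos {d : ℕ} (hd : 1 ≤ d) (k : ℕ) : 0 < gaussianRadialMoment d k := by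
  rw [gaussianRadialMoment_eq hd]
  have : (1 : ℝ) ≤ d := by exact_mod_cast hd
  have := Real.Gamma_pos_of_pos (s := ((d : ℝ) + k) / 2) (by positivity)
  positivity

lemma gaussianRadialMoment_add_two {d : ℕ} (hd : 1 ≤ d) (k : ℕ) :
    gaussianRadialMoment d (k + 2) = ((d : ℝ) + k) * gaussianRadialMoment d k := by
  rw [gaussianRadialMoment_eq hd, gaussianRadialMoment_eq hd]
  have : (1 : ℝ) ≤ d := by exact_mod_cast hd
  have hpos : 0 < (d : ℝ) + k := by positivity
  have e1 : ((d : ℝ) + (k + 2 : ℕ)) / 2 = ((d : ℝ) + k) / 2 + 1 := by push_cast; ring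
  have e2 : -((d : ℝ) + (k + 2 : ℕ)) / 2 = -((d : ℝ) + k) / 2 - 1 := by push_cast; ring
  rw [e1, e2, Real.Gamma_add_one (by positivity), Real.rpow_sub_one (by norm_num)]
  ring

lemma eval_smul_of_isHomogeneous {d k : ℕ} {P : MvPolynomial (Fin d) ℝ} (hP : P.IsHomogeneous k)
    (r : ℝ) (x : Fin d → ℝ) :
    MvPolynomial.eval (fun i => r * x i) P = r ^ k * MvPolynomial.eval x P := by
  rw [MvPolynomial.eval_eq', MvPolynomial.eval_eq', Finset.mul_sum]
  refine Finset.sum_congr rfl fun s hs => ?_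
  have hk : ∑ i, s i = k := by
    have := hP (MvPolynomial.mem_support_iff.1 hs)
    simpa [Finsupp.weight_apply, Finsupp.sum_fintype] using this
  simp only [mul_pow, Finset.prod_mul_distrib, Finset.prod_pow_eq_pow_sum, hk]
  ring

lemma integral_eval_mul_gaussian {d : ℕ} (hd : 1 ≤ d) {k : ℕ} {P : MvPolynomial (Fin d) ℝ}
    (hP : P.IsHomogeneous k) :
    ∫ x : EuclideanSpace ℝ (Fin d),
      MvPolynomial.eval (fun i => x i) P * Real.exp (-(1 / 2) * ‖x‖ ^ 2) =
      sphIntegral P * gaussianRadialMoment d k := by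
  have : NeZero d := ⟨by omega⟩
  let E := EuclideanSpace ℝ (Fin d)
  let μ : Measure E := volume
  let F : E → ℝ := fun x => MvPolynomial.eval (fun i => x i) P * Real.exp (-(1 / 2) * ‖x‖ ^ 2)
  let f : Sph d → ℝ := fun x => MvPolynomial.eval (fun i => (x : E) i) P
  let g : Set.Ioi (0 : ℝ) → ℝ := fun r => r.1 ^ k * Real.exp (-(1 / 2) * r.1 ^ 2)
  have key := μ.measurePreserving_homeomorphUnitSphereProd.integral_comp
        (Homeomorph.measurableEmbedding _) (fun z => f z.1 * g z.2)
  calc ∫ x, F x ∂μ = ∫ x : ({(0)}ᶜ : Set E), F x ∂(μ.comap (↑)) := by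
        rw [integral_subtype_comap (measurableSet_singleton _).compl F, restrict_compl_singleton]
    _ = ∫ x : ({(0)}ᶜ : Set E), (fun z => f z.1 * g z.2) (homeomorphUnitSphereProd E x)
          ∂(μ.comap (↑)) := by
        refine integral_congr_ae (.of_forall fun x => ?_)
        have hx : ‖(x : E)‖ ≠ 0 := norm_ne_zero_iff.2 x.2
        have h := eval_smul_of_isHomogeneous hP ‖(x : E)‖
          (fun i => ((homeomorphUnitSphereProd E x).1 : E) i)
        have h2 : (fun i => ‖(x : E)‖ * ((homeomorphUnitSphereProd E x).1 : E) i) =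
            fun i => (x : E) i := by
          ext i
          rw [homeomorphUnitSphereProd_apply_fst_coe]
          exact mul_inv_cancel_left₀ hx _
        rw [h2] at h
        simp only [F, f, g, h, homeomorphUnitSphereProd_apply_snd_coe]
        ring
    _ = sphIntegral P * gaussianRadialMoment d k := by
        rw [key, integral_prod_mul]
        congr 1
        simp only [Measure.volumeIoiPow, ENNReal.ofReal]
        rw [integral_withDensity_eq_integral_smul, integral_subtype_comap measurableSet_Ioi
          fun a => Real.toNNReal (a ^ (Module.finrank ℝ E - 1)) •
            (a ^ k * Real.exp (-(1 / 2) * a ^ 2)), gaussianRadialMoment,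
          setIntegral_congr_fun measurableSet_Ioi fun x hx ↦ ?_]
        · rw [NNReal.smul_def, Real.coe_toNNReal _ (pow_nonneg hx.out.le _)]
          simp [E]
        · exact (measurable_subtype_coe.pow_const _).real_toNNReal

lemma isHomogeneous_polyLaplacian {d k : ℕ} {P : MvPolynomial (Fin d) ℝ} (hP : P.IsHomogeneous k) :
    (polyLaplacian P).IsHomogeneous (k - 2) :=
  MvPolynomial.IsHomogeneous.sum _ _ _ fun _ _ => hP.pderiv.pderiv

lemma integral_pderiv_mul_gaussian {d : ℕ} (hd : 1 ≤ d) {k : ℕ} {P : MvPolynomial (Fin d) ℝ}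
    (hP : P.IsHomogeneous k) (i : Fin d) :
    ∫ x : EuclideanSpace ℝ (Fin d),
      MvPolynomial.eval (fun i => x i) (MvPolynomial.pderiv i P) * Real.exp (-(1 / 2) * ‖x‖ ^ 2) =
    ∫ x : EuclideanSpace ℝ (Fin d),
      MvPolynomial.eval (fun i => x i) (MvPolynomial.X i * P) *
        Real.exp (-(1 / 2) * ‖x‖ ^ 2) := by
  have hP1 : ∀ x : EuclideanSpace ℝ (Fin d), fderiv ℝ
      (fun x : EuclideanSpace ℝ (Fin d) => MvPolynomial.eval (fun i => x i) P) x
        (EuclideanSpace.single i 1) = MvPolynomial.eval (fun i => x i) (MvPolynomial.pderiv i P) := by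
    intro x
    rw [(hasFDerivAt_eval_euclidean P x).fderiv]
    simp
  have hg : ∀ x : EuclideanSpace ℝ (Fin d), HasFDerivAt
      (fun x : EuclideanSpace ℝ (Fin d) => Real.exp (-(1 / 2) * ‖x‖ ^ 2)) 
      (Real.exp (-(1 / 2) * ‖x‖ ^ 2) • (-(1 / 2 : ℝ)) • (2 • innerSL ℝ x)) x := fun x =>
    (((hasStrictFDerivAt_norm_sq x).hasFDerivAt).const_mul (-(1 / 2 : ℝ))).exp
  have hg1 : ∀ x : EuclideanSpace ℝ (Fin d), fderiv ℝ
      (fun x : EuclideanSpace ℝ (Fin d) => Real.exp (-(1 / 2) * ‖x‖ ^ 2)) x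
        (EuclideanSpace.single i 1) = -(x i * Real.exp (-(1 / 2) * ‖x‖ ^ 2)) := by
    intro x
    rw [(hg x).fderiv]
    simp [EuclideanSpace.inner_single_right]
    ring
  have hXP : (MvPolynomial.X i * P).IsHomogeneous (1 + k) := (MvPolynomial.isHomogeneous_X ℝ i).mul hP
  have hint := integrable_eval_mul_gaussian hd hXP
  have h := integral_mul_fderiv_eq_neg_fderiv_mul_of_integrable
    (μ := (volume : Measure (EuclideanSpace ℝ (Fin d))))
    (f := fun x : EuclideanSpace ℝ (Fin d) => MvPolynomial.eval (fun i => x i) P)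
    (g := fun x : EuclideanSpace ℝ (Fin d) => Real.exp (-(1 / 2) * ‖x‖ ^ 2))
    (v := EuclideanSpace.single i 1) ?_ ?_ (integrable_eval_mul_gaussian hd hP)
    (fun x _ => (hasFDerivAt_eval_euclidean P x).differentiableAt)
    (fun x _ => (hg x).differentiableAt)
  · simp only [hP1, hg1] at h
    rw [← neg_inj, ← h, ← integral_neg]
    refine integral_congr_ae (.of_forall fun x => ?_)
    simp only [map_mul, MvPolynomial.eval_X]
    ring
  · simp only [hP1]
    exact integrable_eval_mul_gaussian hd hP.pderiv
  · simp only [hg1]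
    refine hint.neg.congr (.of_forall fun x => ?_)
    simp only [map_mul, MvPolynomial.eval_X, Pi.neg_apply]
    ring

lemma integral_polyLaplacian_mul_gaussian {d : ℕ} (hd : 1 ≤ d) {k : ℕ}
    {P : MvPolynomial (Fin d) ℝ} (hP : P.IsHomogeneous k) :
    ∫ x : EuclideanSpace ℝ (Fin d),
      MvPolynomial.eval (fun i => x i) (polyLaplacian P) * Real.exp (-(1 / 2) * ‖x‖ ^ 2) =
    k * ∫ x : EuclideanSpace ℝ (Fin d),
      MvPolynomial.eval (fun i => x i) P * Real.exp (-(1 / 2) * ‖x‖ ^ 2) := by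
  have h1 : ∀ i : Fin d, (MvPolynomial.X i * MvPolynomial.pderiv i P).IsHomogeneous (1 + (k - 1)) :=
    fun i => (MvPolynomial.isHomogeneous_X ℝ i).mul hP.pderiv
  simp only [polyLaplacian, map_sum, Finset.sum_mul]
  rw [integral_finsetSum _ fun i _ => integrable_eval_mul_gaussian hd hP.pderiv.pderiv]
  simp only [integral_pderiv_mul_gaussian hd hP.pderiv]
  rw [← integral_finsetSum _ fun i _ => integrable_eval_mul_gaussian hd (h1 i),
    ← integral_const_mul]
  refine integral_congr_ae (.of_forall fun x => ?_)
  simp only [← Finset.sum_mul, ← map_sum, hP.sum_X_mul_pderiv]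
  simp [mul_assoc]

/-- Integrating the Laplacian of a homogeneous polynomial over the sphere. -/
theorem sphIntegral_polyLaplacian {d : ℕ} (hd : 2 ≤ d) {k : ℕ}
    {P : MvPolynomial (Fin d) ℝ} (hP : P.IsHomogeneous k) :
    sphIntegral (polyLaplacian P) = k * ((k : ℝ) + d - 2) * sphIntegral P := by
  have hd1 : 1 ≤ d := by omega
  have h := integral_polyLaplacian_mul_gaussian hd1 hP
  rw [integral_eval_mul_gaussian hd1 hP,
    integral_eval_mul_gaussian hd1 (isHomogeneous_polyLaplacian hP)] at h
  have hpos := gaussianRadialMoment_pos hd1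
  obtain hk | hk : k < 2 ∨ 2 ≤ k := by omega
  · have h0 : polyLaplacian P = 0 := by
      refine Finset.sum_eq_zero fun i _ => ?_
      have : (MvPolynomial.pderiv i P).IsHomogeneous 0 := by
        have := hP.pderiv (i := i)
        rwa [show k - 1 = 0 by omega] at this
      rw [← MvPolynomial.totalDegree_zero_iff_isHomogeneous,
        MvPolynomial.totalDegree_eq_zero_iff_eq_C] at this
      rw [this, MvPolynomial.pderiv_C]
    have h1 : (k : ℝ) * sphIntegral P = 0 := by
      have h2 : sphIntegral (polyLaplacian P) = 0 := by simp [h0, sphIntegral]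
      rw [h2, zero_mul, ← mul_assoc] at h
      exact (mul_eq_zero.1 h.symm).resolve_right (hpos k).ne'
    rw [mul_right_comm, h1]
    simp [h0, sphIntegral]
  · obtain ⟨j, rfl⟩ := Nat.exists_eq_add_of_le' hk
    rw [Nat.add_sub_cancel, gaussianRadialMoment_add_two hd1] at h
    refine mul_right_cancel₀ (hpos j).ne' (h.trans ?_)
    push_cast
    ring

section ZonalPolynomial

open MvPolynomial

variable {d : ℕ}

lemma sphIntegral_add (P Q : MvPolynomial (Fin d) ℝ) :
    sphIntegral (P + Q) = sphIntegral P + sphIntegral Q := by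
  simp only [sphIntegral, map_add]
  exact integral_add (integrable_of_continuous_sph (continuous_eval_sph P))
    (integrable_of_continuous_sph (continuous_eval_sph Q))

lemma sphIntegral_C_mul (a : ℝ) (P : MvPolynomial (Fin d) ℝ) :
    sphIntegral (C a * P) = a * sphIntegral P := by
  simp only [sphIntegral, map_mul, eval_C]
  exact integral_const_mul _ _

lemma sphIntegral_sum {ι : Type*} (s : Finset ι) (P : ι → MvPolynomial (Fin d) ℝ) :
    sphIntegral (∑ i ∈ s, P i) = ∑ i ∈ s, sphIntegral (P i) := by
  simp only [sphIntegral, map_sum]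
  exact integral_finsetSum _ fun i _ => integrable_of_continuous_sph (continuous_eval_sph (P i))

lemma sphIntegral_congr {P Q : MvPolynomial (Fin d) ℝ}
    (h : ∀ x : Sph d, eval (fun i => (x : EuclideanSpace ℝ (Fin d)) i) P =
      eval (fun i => (x : EuclideanSpace ℝ (Fin d)) i) Q) :
    sphIntegral P = sphIntegral Q :=
  integral_congr_ae (.of_forall h)

lemma polyLaplacian_mul (P Q : MvPolynomial (Fin d) ℝ) :
    polyLaplacian (P * Q) = P * polyLaplacian Q + Q * polyLaplacian P +
      2 * ∑ i, pderiv i P * pderiv i Q := by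
  simp only [polyLaplacian, Finset.mul_sum, ← Finset.sum_add_distrib]
  refine Finset.sum_congr rfl fun i _ => ?_
  simp only [Derivation.leibniz, map_add, smul_eq_mul]
  ring

lemma polyLaplacian_sum {ι : Type*} (s : Finset ι) (P : ι → MvPolynomial (Fin d) ℝ) :
    polyLaplacian (∑ j ∈ s, P j) = ∑ j ∈ s, polyLaplacian (P j) := by
  simp only [polyLaplacian, map_sum]
  exact Finset.sum_comm

lemma polyLaplacian_C_mul (a : ℝ) (P : MvPolynomial (Fin d) ℝ) :
    polyLaplacian (C a * P) = C a * polyLaplacian P := by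
  simp [polyLaplacian, Finset.mul_sum]

lemma polyLaplacian_pow (P : MvPolynomial (Fin d) ℝ) (m : ℕ) :
    polyLaplacian (P ^ m) = m * P ^ (m - 1) * polyLaplacian P +
      m * (m - 1 : ℕ) * P ^ (m - 2) * ∑ i, pderiv i P ^ 2 := by
  simp only [polyLaplacian, Finset.mul_sum, ← Finset.sum_add_distrib]
  refine Finset.sum_congr rfl fun i _ => ?_
  rw [pderiv_pow, Derivation.leibniz, Derivation.leibniz, pderiv_pow, Nat.sub_sub]
  simp only [Derivation.map_natCast, smul_eq_mul]
  ring

/-- The linear polynomial `x ↦ y · x`. -/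
def linPoly (y : Fin d → ℝ) : MvPolynomial (Fin d) ℝ := ∑ i, C (y i) * X i

/-- The polynomial `x ↦ |x|² - (y · x)²`. -/
def perpPoly (y : Fin d → ℝ) : MvPolynomial (Fin d) ℝ := ∑ i, X i ^ 2 - linPoly y ^ 2

/-- The derivative in the direction `y`. -/
def dirDeriv (y : Fin d → ℝ) (P : MvPolynomial (Fin d) ℝ) : MvPolynomial (Fin d) ℝ :=
  ∑ i, C (y i) * pderiv i P

lemma isHomogeneous_linPoly (y : Fin d → ℝ) : (linPoly y).IsHomogeneous 1 :=
  IsHomogeneous.sum _ _ _ fun i _ => by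
    simpa using (isHomogeneous_C (Fin d) (y i)).mul (isHomogeneous_X ℝ i)

lemma isHomogeneous_perpPoly (y : Fin d → ℝ) : (perpPoly y).IsHomogeneous 2 :=
  (IsHomogeneous.sum _ _ _ fun i _ => by simpa using (isHomogeneous_X ℝ i).pow 2).sub
    (by simpa using (isHomogeneous_linPoly y).pow 2)

lemma pderiv_linPoly (y : Fin d → ℝ) (i : Fin d) : pderiv i (linPoly y) = C (y i) := by
  simp [linPoly, pderiv_X, Pi.single_apply]

lemma polyLaplacian_linPoly (y : Fin d → ℝ) : polyLaplacian (linPoly y) = 0 := by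
  simp [polyLaplacian, pderiv_linPoly]

lemma pderiv_perpPoly (y : Fin d → ℝ) (i : Fin d) :
    pderiv i (perpPoly y) = 2 * X i - 2 * linPoly y * C (y i) := by
  have : ∀ j : Fin d, pderiv i (X j ^ 2 : MvPolynomial (Fin d) ℝ) =
      if j = i then 2 * X i else 0 := by
    intro j
    rw [pderiv_pow, pderiv_X, Pi.single_apply]
    split_ifs with h
    · subst h; simp
    · simp
  rw [perpPoly, map_sub, map_sum, pderiv_pow, pderiv_linPoly]
  simp [this]

lemma sum_C_sq {y : Fin d → ℝ} (hy : ∑ i, y i ^ 2 = 1) :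
    ∑ i, (C (y i) : MvPolynomial (Fin d) ℝ) ^ 2 = 1 := by
  simp_rw [← C_pow, ← map_sum, hy, C_1]

lemma polyLaplacian_perpPoly {y : Fin d → ℝ} (hy : ∑ i, y i ^ 2 = 1) :
    polyLaplacian (perpPoly y) = 2 * d - 2 := by
  have h : ∀ i, pderiv i (pderiv i (perpPoly y)) = 2 - 2 * C (y i) ^ 2 := by
    intro i
    have h2 : pderiv i (2 : MvPolynomial (Fin d) ℝ) = 0 := by
      rw [← map_ofNat C, pderiv_C]
    simp only [pderiv_perpPoly, map_sub, Derivation.leibniz, pderiv_linPoly, pderiv_X_self, h2,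
      pderiv_C, smul_eq_mul]
    ring
  simp only [polyLaplacian, h, Finset.sum_sub_distrib, ← Finset.mul_sum, sum_C_sq hy]
  simp
  ring

lemma sum_pderiv_linPoly_sq {y : Fin d → ℝ} (hy : ∑ i, y i ^ 2 = 1) :
    ∑ i, pderiv i (linPoly y) ^ 2 = 1 := by
  simp only [pderiv_linPoly, sum_C_sq hy]

lemma sum_pderiv_linPoly_mul_perpPoly {y : Fin d → ℝ} (hy : ∑ i, y i ^ 2 = 1) :
    ∑ i, pderiv i (linPoly y) * pderiv i (perpPoly y) = 0 := by
  have h : ∀ i, pderiv i (linPoly y) * pderiv i (perpPoly y) =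
      2 * (C (y i) * X i) - 2 * linPoly y * C (y i) ^ 2 := by
    intro i; rw [pderiv_linPoly, pderiv_perpPoly]; ring
  simp only [h, Finset.sum_sub_distrib, ← Finset.mul_sum, sum_C_sq hy]
  rw [← linPoly]
  ring

lemma sum_pderiv_perpPoly_sq {y : Fin d → ℝ} (hy : ∑ i, y i ^ 2 = 1) :
    ∑ i, pderiv i (perpPoly y) ^ 2 = 4 * perpPoly y := by
  have h : ∀ i, pderiv i (perpPoly y) ^ 2 =
      4 * X i ^ 2 - 8 * linPoly y * (C (y i) * X i) + 4 * linPoly y ^ 2 * C (y i) ^ 2 := by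
    intro i; rw [pderiv_perpPoly]; ring
  simp only [h, Finset.sum_add_distrib, Finset.sum_sub_distrib, ← Finset.mul_sum, sum_C_sq hy]
  rw [← linPoly, perpPoly]
  ring

lemma polyLaplacian_linPoly_pow {y : Fin d → ℝ} (hy : ∑ i, y i ^ 2 = 1) (a : ℕ) :
    polyLaplacian (linPoly y ^ a) = a * (a - 1 : ℕ) * linPoly y ^ (a - 2) := by
  rw [polyLaplacian_pow, polyLaplacian_linPoly, sum_pderiv_linPoly_sq hy]
  ring

lemma polyLaplacian_perpPoly_pow {y : Fin d → ℝ} (hy : ∑ i, y i ^ 2 = 1) (b : ℕ) :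
    polyLaplacian (perpPoly y ^ (b + 1)) =
      C (2 * ((b : ℝ) + 1) * (2 * b + d - 1)) * perpPoly y ^ b := by
  rw [polyLaplacian_pow, polyLaplacian_perpPoly hy, sum_pderiv_perpPoly_sq hy]
  rcases b with _ | b
  · simp [map_ofNat C 2]
    ring
  · rw [show b + 1 + 1 - 2 = b by omega, show b + 1 + 1 - 1 = b + 1 by omega]
    simp only [map_mul, map_add, map_sub, map_natCast, map_ofNat, map_one]
    push_cast
    ring

lemma sum_pderiv_linPoly_pow_mul_perpPoly_pow {y : Fin d → ℝ} (hy : ∑ i, y i ^ 2 = 1)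
    (a b : ℕ) : ∑ i, pderiv i (linPoly y ^ a) * pderiv i (perpPoly y ^ b) = 0 := by
  have h : ∀ i, pderiv i (linPoly y ^ a) * pderiv i (perpPoly y ^ b) =
      (a * b : MvPolynomial (Fin d) ℝ) * linPoly y ^ (a - 1) * perpPoly y ^ (b - 1) *
        (pderiv i (linPoly y) * pderiv i (perpPoly y)) := by
    intro i; rw [pderiv_pow, pderiv_pow]; ring
  simp only [h, ← Finset.mul_sum, sum_pderiv_linPoly_mul_perpPoly hy, mul_zero]

/-- The zonal polynomial of degree `n` with pole `y`, whose coefficients are built from a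
sequence `w`. -/
def zonalPoly (w : ℕ → ℝ) (n : ℕ) (y : Fin d → ℝ) : MvPolynomial (Fin d) ℝ :=
  ∑ k ∈ Finset.range (n + 1),
    C ((n.choose (2 * k) : ℝ) * w k * (-1) ^ k) * (linPoly y ^ (n - 2 * k) * perpPoly y ^ k)

lemma isHomogeneous_zonalPoly (w : ℕ → ℝ) (n : ℕ) (y : Fin d → ℝ) :
    (zonalPoly w n y).IsHomogeneous n := by
  refine IsHomogeneous.sum _ _ _ fun k _ => ?_
  by_cases hk : 2 * k ≤ n
  · have := ((isHomogeneous_linPoly y).pow (n - 2 * k)).mul ((isHomogeneous_perpPoly y).pow k)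
    have := (isHomogeneous_C (Fin d) ((n.choose (2 * k) : ℝ) * w k * (-1) ^ k)).mul this
    rwa [show 0 + (1 * (n - 2 * k) + 2 * k) = n by omega] at this
  · rw [Nat.choose_eq_zero_of_lt (by omega)]
    simpa using isHomogeneous_zero _ _ _

lemma choose_two_step (n k : ℕ) :
    (n.choose (2 * (k + 1)) : ℝ) * (2 * k + 2) * (2 * k + 1) =
      n.choose (2 * k) * ((n - 2 * k : ℕ) * (n - 2 * k - 1 : ℕ)) := by
  have h1 := Nat.choose_succ_right_eq n (2 * k)
  have h2 := Nat.choose_succ_right_eq n (2 * k + 1)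
  have e : (n.choose (2 * (k + 1))) * (2 * k + 2) * (2 * k + 1) =
      n.choose (2 * k) * ((n - 2 * k) * (n - 2 * k - 1)) := by
    rw [show 2 * (k + 1) = 2 * k + 1 + 1 by ring, h2, mul_right_comm, h1, Nat.sub_sub]
    ring
  exact_mod_cast e

lemma polyLaplacian_zonalPoly {w : ℕ → ℝ}
    (hw : ∀ k : ℕ, w (k + 1) * (2 * k + d - 1) = (2 * k + 1) * w k)
    (n : ℕ) {y : Fin d → ℝ} (hy : ∑ i, y i ^ 2 = 1) :
    polyLaplacian (zonalPoly w n y) = 0 := by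
  let c : ℕ → ℝ := fun k => (n.choose (2 * k) : ℝ) * w k * (-1) ^ k
  let A : ℕ → MvPolynomial (Fin d) ℝ := fun k =>
    C (c k * ((n - 2 * k : ℕ) * (n - 2 * k - 1 : ℕ))) *
      (linPoly y ^ (n - 2 * k - 2) * perpPoly y ^ k)
  let B : ℕ → MvPolynomial (Fin d) ℝ := fun k =>
    C (c k) * (linPoly y ^ (n - 2 * k) * polyLaplacian (perpPoly y ^ k))
  have h : ∀ k, polyLaplacian (C (c k) * (linPoly y ^ (n - 2 * k) * perpPoly y ^ k)) =
      A k + B k := by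
    intro k
    rw [polyLaplacian_C_mul, polyLaplacian_mul, polyLaplacian_linPoly_pow hy,
      sum_pderiv_linPoly_pow_mul_perpPoly_pow hy]
    simp only [A, B, map_mul, map_natCast]
    ring
  have hAB : ∀ k, A k + B (k + 1) = 0 := by
    intro k
    have hc : c k * ((n - 2 * k : ℕ) * (n - 2 * k - 1 : ℕ)) +
        c (k + 1) * (2 * (k + 1) * (2 * k + d - 1)) = 0 := by
      have h1 := choose_two_step n k
      have h2 := hw k
      simp only [c]
      rw [pow_succ]
      linear_combination (-(-1 : ℝ) ^ k * w k) * h1 -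
        ((-1 : ℝ) ^ k * (n.choose (2 * (k + 1)) : ℝ) * (2 * k + 2)) * h2
    simp only [A, B]
    rw [polyLaplacian_perpPoly_pow hy, show n - 2 * (k + 1) = n - 2 * k - 2 by omega,
      ← mul_left_comm (C _), ← mul_assoc (C _) (C _), ← map_mul, ← add_mul, ← map_add, hc]
    simp
  have hA : A n = 0 := by
    rcases n with _ | n
    · simp [A]
    · simp only [A, c]
      rw [Nat.choose_eq_zero_of_lt (by omega)]
      simp
  have hB : B 0 = 0 := by
    simp [B, polyLaplacian]
  rw [zonalPoly, polyLaplacian_sum, Finset.sum_congr rfl fun k _ => h k, Finset.sum_add_distrib,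
    Finset.sum_range_succ, hA, Finset.sum_range_succ' B, hB, add_zero, add_zero,
    ← Finset.sum_add_distrib]
  exact Finset.sum_eq_zero fun k _ => hAB k

lemma isHomogeneous_dirDeriv (y : Fin d → ℝ) {n : ℕ} {P : MvPolynomial (Fin d) ℝ}
    (hP : P.IsHomogeneous n) : (dirDeriv y P).IsHomogeneous (n - 1) :=
  IsHomogeneous.sum _ _ _ fun i _ => by
    simpa using (isHomogeneous_C (Fin d) (y i)).mul (hP.pderiv (i := i))

lemma pderiv_comm (i j : Fin d) (P : MvPolynomial (Fin d) ℝ) :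
    pderiv i (pderiv j P) = pderiv j (pderiv i P) := by
  have h : ⁅pderiv (R := ℝ) i, pderiv j⁆ =
      (0 : Derivation ℝ (MvPolynomial (Fin d) ℝ) (MvPolynomial (Fin d) ℝ)) := by
    refine MvPolynomial.derivation_ext fun k => ?_
    simp [Derivation.commutator_apply, pderiv_X, Pi.single_apply, apply_ite]
  have := DFunLike.congr_fun h P
  rw [Derivation.commutator_apply] at this
  exact sub_eq_zero.1 this

lemma polyLaplacian_dirDeriv (y : Fin d → ℝ) {P : MvPolynomial (Fin d) ℝ}
    (hP : polyLaplacian P = 0) : polyLaplacian (dirDeriv y P) = 0 := by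
  rw [dirDeriv, polyLaplacian_sum]
  refine Finset.sum_eq_zero fun i _ => ?_
  have : polyLaplacian (pderiv i P) = pderiv i (polyLaplacian P) := by
    simp only [polyLaplacian, map_sum]
    refine Finset.sum_congr rfl fun j _ => ?_
    rw [pderiv_comm j i, pderiv_comm j i]
  rw [polyLaplacian_C_mul, this, hP]
  simp

lemma polyLaplacian_mul_linPoly_pow {y : Fin d → ℝ} (hy : ∑ i, y i ^ 2 = 1)
    {P : MvPolynomial (Fin d) ℝ} (hP : polyLaplacian P = 0) (m : ℕ) :
    polyLaplacian (P * linPoly y ^ m) =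
      C (2 * m : ℝ) * (dirDeriv y P * linPoly y ^ (m - 1)) +
        C (m * (m - 1 : ℕ) : ℝ) * (P * linPoly y ^ (m - 2)) := by
  have h : ∀ i, pderiv i P * pderiv i (linPoly y ^ m) =
      (m : MvPolynomial (Fin d) ℝ) * linPoly y ^ (m - 1) * (C (y i) * pderiv i P) := by
    intro i; rw [pderiv_pow, pderiv_linPoly]; ring
  rw [polyLaplacian_mul, polyLaplacian_linPoly_pow hy, hP]
  simp only [h, ← Finset.mul_sum]
  rw [← dirDeriv]
  simp only [map_mul, map_natCast, map_ofNat]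
  ring

lemma sphIntegral_mul_linPoly_pow_step (hd : 2 ≤ d) {y : Fin d → ℝ} (hy : ∑ i, y i ^ 2 = 1)
    {n : ℕ} {P : MvPolynomial (Fin d) ℝ} (hPn : P.IsHomogeneous n) (hP : polyLaplacian P = 0)
    (m : ℕ) :
    ((n + m : ℕ) : ℝ) * ((n + m : ℕ) + d - 2) * sphIntegral (P * linPoly y ^ m) =
      2 * m * sphIntegral (dirDeriv y P * linPoly y ^ (m - 1)) +
        m * (m - 1 : ℕ) * sphIntegral (P * linPoly y ^ (m - 2)) := by
  have h := sphIntegral_polyLaplacian hd (hPn.mul ((isHomogeneous_linPoly y).pow m))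
  rw [polyLaplacian_mul_linPoly_pow hy hP, sphIntegral_add, sphIntegral_C_mul,
    sphIntegral_C_mul, one_mul] at h
  exact h.symm

lemma sphIntegral_mul_linPoly_pow_eq_zero (hd : 2 ≤ d) {y : Fin d → ℝ}
    (hy : ∑ i, y i ^ 2 = 1) (m : ℕ) : ∀ {n : ℕ} {P : MvPolynomial (Fin d) ℝ},
    P.IsHomogeneous n → polyLaplacian P = 0 → m < n → sphIntegral (P * linPoly y ^ m) = 0 := by
  induction m using Nat.strong_induction_on with
  | _ m ih =>
    intro n P hPn hP hmn
    have h := sphIntegral_mul_linPoly_pow_step hd hy hPn hP m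
    have h1 : (2 * m : ℝ) * sphIntegral (dirDeriv y P * linPoly y ^ (m - 1)) = 0 := by
      rcases m with _ | m
      · simp
      · rw [ih (m + 1 - 1) (by omega) (isHomogeneous_dirDeriv y hPn)
          (polyLaplacian_dirDeriv y hP) (by omega), mul_zero]
    have h2 : (m * (m - 1 : ℕ) : ℝ) * sphIntegral (P * linPoly y ^ (m - 2)) = 0 := by
      rcases m with _ | _ | m
      · simp
      · simp
      · rw [ih (m + 1 + 1 - 2) (by omega) hPn hP (by omega), mul_zero]
    rw [h1, h2, add_zero] at h
    have hn : (0 : ℝ) < (n + m : ℕ) := by exact_mod_cast (by omega : 0 < n + m)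
    have hd' : (2 : ℝ) ≤ d := by exact_mod_cast hd
    have : (0 : ℝ) < ((n + m : ℕ) : ℝ) * ((n + m : ℕ) + d - 2) :=
      mul_pos hn (by linarith)
    exact (mul_eq_zero.1 h).resolve_left this.ne'

lemma eval_dirDeriv_self (y : Fin d → ℝ) {n : ℕ} {P : MvPolynomial (Fin d) ℝ}
    (hP : P.IsHomogeneous n) : eval y (dirDeriv y P) = n * eval y P := by
  have h := congrArg (eval y) hP.sum_X_mul_pderiv
  simpa [dirDeriv] using h

lemma sphIntegral_mul_linPoly_pow_self (hd : 2 ≤ d) {y : Fin d → ℝ}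
    (hy : ∑ i, y i ^ 2 = 1) (n : ℕ) : ∀ {P : MvPolynomial (Fin d) ℝ},
    P.IsHomogeneous n → polyLaplacian P = 0 →
      sphIntegral (P * linPoly y ^ n) * ∏ k ∈ Finset.range n, (2 * (k : ℝ) + d) =
        (sphMeasure d).real Set.univ * n.factorial * eval y P := by
  induction n with
  | zero =>
    intro P hPn hP
    rw [← totalDegree_zero_iff_isHomogeneous, totalDegree_eq_zero_iff_eq_C] at hPn
    rw [hPn]
    simp [sphIntegral]
  | succ n ih =>
    intro P hPn hP
    have h := sphIntegral_mul_linPoly_pow_step hd hy hPn hP (n + 1)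
    have h2 : ((n + 1 : ℕ) * (n + 1 - 1 : ℕ) : ℝ) *
        sphIntegral (P * linPoly y ^ (n + 1 - 2)) = 0 := by
      rw [sphIntegral_mul_linPoly_pow_eq_zero hd hy _ hPn hP (by omega), mul_zero]
    have h3 := ih (by simpa using isHomogeneous_dirDeriv y hPn) (polyLaplacian_dirDeriv y hP)
    rw [eval_dirDeriv_self y hPn] at h3
    rw [h2, add_zero, Nat.add_sub_cancel] at h
    have hn : (0 : ℝ) < (n : ℝ) + 1 := by positivity
    have h4 : (2 * n + d : ℝ) * sphIntegral (P * linPoly y ^ (n + 1)) =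
        sphIntegral (dirDeriv y P * linPoly y ^ n) := by
      refine mul_left_cancel₀ (a := 2 * ((n : ℝ) + 1)) (by positivity) ?_
      push_cast at h
      linear_combination h
    rw [Finset.prod_range_succ, Nat.factorial_succ]
    push_cast at h3 ⊢
    linear_combination (∏ k ∈ Finset.range n, (2 * (k : ℝ) + d)) * h4 + h3

lemma eval_linPoly (y x : Fin d → ℝ) : eval x (linPoly y) = ∑ i, y i * x i := by
  simp [linPoly]

lemma eval_perpPoly (y x : Fin d → ℝ) :
    eval x (perpPoly y) = ∑ i, x i ^ 2 - (∑ i, y i * x i) ^ 2 := by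
  simp [perpPoly, eval_linPoly]

lemma sum_sq_sph (x : Sph d) : ∑ i, (x : EuclideanSpace ℝ (Fin d)) i ^ 2 = 1 := by
  rw [← EuclideanSpace.real_norm_sq_eq, norm_eq_of_mem_sphere, one_pow]

lemma sphIntegral_perpPoly_pow_succ (y : Fin d → ℝ) (P : MvPolynomial (Fin d) ℝ) (a b : ℕ) :
    sphIntegral (P * (linPoly y ^ a * perpPoly y ^ (b + 1))) =
      sphIntegral (P * (linPoly y ^ a * perpPoly y ^ b)) -
        sphIntegral (P * (linPoly y ^ (a + 2) * perpPoly y ^ b)) := by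
  rw [eq_sub_iff_add_eq, ← sphIntegral_add]
  refine sphIntegral_congr fun x => ?_
  simp only [map_add, map_mul, map_pow, eval_perpPoly, sum_sq_sph, eval_linPoly]
  ring

lemma sphIntegral_mul_perpPoly_pow (hd : 2 ≤ d) {y : Fin d → ℝ} (hy : ∑ i, y i ^ 2 = 1)
    {n : ℕ} {P : MvPolynomial (Fin d) ℝ} (hPn : P.IsHomogeneous n) (hP : polyLaplacian P = 0)
    (b : ℕ) : ∀ a : ℕ,
    (a + 2 * b < n → sphIntegral (P * (linPoly y ^ a * perpPoly y ^ b)) = 0) ∧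
    (a + 2 * b = n → sphIntegral (P * (linPoly y ^ a * perpPoly y ^ b)) =
      (-1) ^ b * sphIntegral (P * linPoly y ^ n)) := by
  induction b with
  | zero =>
    refine fun a => ⟨fun h => ?_, fun h => ?_⟩
    · simpa using sphIntegral_mul_linPoly_pow_eq_zero hd hy a hPn hP (by omega)
    · simp [← h]
  | succ b ih =>
    refine fun a => ⟨fun h => ?_, fun h => ?_⟩ <;> rw [sphIntegral_perpPoly_pow_succ]
    · rw [(ih a).1 (by omega), (ih (a + 2)).1 (by omega), sub_zero]
    · rw [(ih a).1 (by omega), (ih (a + 2)).2 (by omega)]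
      ring

/-- The reproducing property of the zonal polynomial. -/
theorem sphIntegral_mul_zonalPoly (hd : 2 ≤ d) (w : ℕ → ℝ) {y : Fin d → ℝ}
    (hy : ∑ i, y i ^ 2 = 1) {n : ℕ} {P : MvPolynomial (Fin d) ℝ} (hPn : P.IsHomogeneous n)
    (hP : polyLaplacian P = 0) :
    sphIntegral (P * zonalPoly w n y) * ∏ k ∈ Finset.range n, (2 * (k : ℝ) + d) =
      (∑ k ∈ Finset.range (n + 1), (n.choose (2 * k) : ℝ) * w k) *
        ((sphMeasure d).real Set.univ * n.factorial * eval y P) := by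
  rw [← sphIntegral_mul_linPoly_pow_self hd hy n hPn hP, ← mul_assoc]
  congr 1
  rw [zonalPoly, Finset.mul_sum, sphIntegral_sum, Finset.sum_mul]
  refine Finset.sum_congr rfl fun k _ => ?_
  rw [mul_left_comm, sphIntegral_C_mul]
  by_cases hk : 2 * k ≤ n
  · rw [(sphIntegral_mul_perpPoly_pow hd hy hPn hP k (n - 2 * k)).2 (by omega)]
    have : ((-1 : ℝ) ^ k) * (-1) ^ k = 1 := by rw [← mul_pow]; simp
    linear_combination ((n.choose (2 * k) : ℝ) * w k * sphIntegral (P * linPoly y ^ n)) * this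
  · rw [Nat.choose_eq_zero_of_lt (by omega)]
    simp

lemma eval_zonalPoly_sph (w : ℕ → ℝ) (n : ℕ) (y : Fin d → ℝ) (x : Sph d) :
    eval (fun i => (x : EuclideanSpace ℝ (Fin d)) i) (zonalPoly w n y) =
      ∑ k ∈ Finset.range (n + 1), (n.choose (2 * k) : ℝ) * w k * (-1) ^ k *
        ((∑ i, y i * (x : EuclideanSpace ℝ (Fin d)) i) ^ (n - 2 * k) *
          (1 - (∑ i, y i * (x : EuclideanSpace ℝ (Fin d)) i) ^ 2) ^ k) := by
  simp only [zonalPoly, map_sum, map_mul, eval_C, map_pow, eval_linPoly, eval_perpPoly, sum_sq_sph]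

end ZonalPolynomial

section ZonalKernel

open Real intervalIntegral

lemma sum_range_two_mul {M : Type*} [AddCommMonoid M] (f : ℕ → M) (N : ℕ) :
    ∑ j ∈ Finset.range (2 * N), f j = ∑ k ∈ Finset.range N, (f (2 * k) + f (2 * k + 1)) := by
  induction N with
  | zero => simp
  | succ N ih => rw [Nat.mul_succ, Finset.sum_range_succ, Finset.sum_range_succ, ih,
      Finset.sum_range_succ, add_assoc]

lemma add_pow_add_sub_pow {R : Type*} [CommRing R] (t x : R) (n : ℕ) :
    (t + x) ^ n + (t - x) ^ n =
      2 * ∑ k ∈ Finset.range (n + 1), (n.choose (2 * k) : R) * (t ^ (n - 2 * k) * x ^ (2 * k)) := by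
  have h : ∀ y : R, (t + y) ^ n =
      ∑ j ∈ Finset.range (2 * (n + 1)), (n.choose j : R) * (t ^ (n - j) * y ^ j) := by
    intro y
    rw [add_comm t y, add_pow]
    rw [← Finset.sum_subset (Finset.range_subset_range.2 (by omega : n + 1 ≤ 2 * (n + 1)))]
    · exact Finset.sum_congr rfl fun j _ => by ring
    · intro j _ hj
      rw [Nat.choose_eq_zero_of_lt (by simpa using hj)]
      simp
  rw [sub_eq_add_neg, h, h, sum_range_two_mul, sum_range_two_mul, ← Finset.sum_add_distrib,
    Finset.mul_sum]
  refine Finset.sum_congr rfl fun k _ => ?_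
  rw [(even_two_mul k).neg_pow, (odd_two_mul_add_one k).neg_pow]
  ring

/-- The moments of `cos` for the probability density proportional to `sin ^ r` on `[0, π]`. -/
def cosMoment (r i : ℕ) : ℝ :=
  (∫ x in (0 : ℝ)..π, cos x ^ i * sin x ^ r) / ∫ x in (0 : ℝ)..π, sin x ^ r

lemma cosMoment_add_two (r i : ℕ) :
    cosMoment r (i + 2) * (i + r + 2) = (i + 1) * cosMoment r i := by
  have hderiv : ∀ x : ℝ, HasDerivAt (fun x => cos x ^ (i + 1) * sin x ^ (r + 1))
      ((i + r + 2) * (cos x ^ (i + 2) * sin x ^ r) - (i + 1) * (cos x ^ i * sin x ^ r)) x := by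
    intro x
    refine (((hasDerivAt_cos x).fun_pow (i + 1)).fun_mul
      ((hasDerivAt_sin x).fun_pow (r + 1))).congr_deriv ?_
    push_cast
    linear_combination (-((i : ℝ) + 1) * cos x ^ i * sin x ^ r) * sin_sq_add_cos_sq x
  have h := integral_eq_sub_of_hasDerivAt (a := 0) (b := π) (fun x _ => hderiv x)
    ((by fun_prop : Continuous _).intervalIntegrable _ _)
  rw [integral_sub ((by fun_prop : Continuous _).intervalIntegrable _ _)
    ((by fun_prop : Continuous _).intervalIntegrable _ _), intervalIntegral.integral_const_mul,
    intervalIntegral.integral_const_mul] at h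
  simp only [sin_pi, sin_zero, ne_eq, Nat.add_eq_zero_iff, one_ne_zero, and_false,
    not_false_eq_true, zero_pow, mul_zero, sub_zero] at h
  rw [cosMoment, cosMoment, div_mul_eq_mul_div, mul_div_assoc']
  congr 1
  linear_combination h

lemma integral_one_add_mul_cos_pow_succ {e : ℝ} (he : e ^ 2 = 1) (r n : ℕ) :
    (∫ x in (0 : ℝ)..π, (1 + e * cos x) ^ (n + 1) * sin x ^ r) * (r + 1 + n) =
      (∫ x in (0 : ℝ)..π, (1 + e * cos x) ^ n * sin x ^ r) * (2 * n + (r + 1)) := by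
  have hderiv : ∀ x : ℝ, HasDerivAt (fun x => e * ((1 + e * cos x) ^ n * sin x ^ (r + 1)))
      ((r + 1 + n) * ((1 + e * cos x) ^ (n + 1) * sin x ^ r) -
        (2 * n + (r + 1)) * ((1 + e * cos x) ^ n * sin x ^ r)) x := by
    intro x
    refine (((((hasDerivAt_cos x).const_mul e).const_add 1).fun_pow n).fun_mul
      ((hasDerivAt_sin x).fun_pow (r + 1)) |>.const_mul e).congr_deriv ?_
    push_cast
    rcases n with _ | n
    · simp only [pow_zero, CharP.cast_eq_zero]
      ring
    · simp only [Nat.add_sub_cancel]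
      push_cast
      have hc := sin_sq_add_cos_sq x
      rw [show e * (((n : ℝ) + 1) * (1 + e * cos x) ^ n * (e * -sin x) * sin x ^ (r + 1) +
        (1 + e * cos x) ^ (n + 1) * (((r : ℝ) + 1) * sin x ^ r * cos x)) =
        (1 + e * cos x) ^ n * sin x ^ r * (-(n + 1) * e ^ 2 * sin x ^ 2 +
          e * (1 + e * cos x) * (r + 1) * cos x) by ring]
      rw [he, show sin x ^ 2 = 1 - e ^ 2 * cos x ^ 2 by rw [he]; linarith]
      ring
  have h := integral_eq_sub_of_hasDerivAt (a := 0) (b := π) (fun x _ => hderiv x)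
    ((by fun_prop : Continuous _).intervalIntegrable _ _)
  rw [integral_sub ((by fun_prop : Continuous _).intervalIntegrable _ _)
    ((by fun_prop : Continuous _).intervalIntegrable _ _), intervalIntegral.integral_const_mul,
    intervalIntegral.integral_const_mul] at h
  simp only [sin_pi, sin_zero, ne_eq, Nat.add_eq_zero_iff, one_ne_zero, and_false,
    not_false_eq_true, zero_pow, mul_zero, sub_zero] at h
  linear_combination h

lemma integral_one_add_mul_cos_pow {e : ℝ} (he : e ^ 2 = 1) (r n : ℕ) :
    (∫ x in (0 : ℝ)..π, (1 + e * cos x) ^ n * sin x ^ r) * ∏ k ∈ Finset.range n, (r + 1 + k : ℝ) =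
      (∫ x in (0 : ℝ)..π, sin x ^ r) * ∏ k ∈ Finset.range n, (2 * k + (r + 1) : ℝ) := by
  induction n with
  | zero => simp
  | succ n ih =>
    rw [Finset.prod_range_succ, Finset.prod_range_succ]
    have h := integral_one_add_mul_cos_pow_succ he r n
    linear_combination (∏ k ∈ Finset.range n, (r + 1 + k : ℝ)) * h + (2 * n + (r + 1)) * ih

lemma sum_choose_mul_cosMoment (r n : ℕ) :
    (∑ k ∈ Finset.range (n + 1), (n.choose (2 * k) : ℝ) * cosMoment r (2 * k)) *
        ∏ k ∈ Finset.range n, (r + 1 + k : ℝ) =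
      ∏ k ∈ Finset.range n, (2 * k + (r + 1) : ℝ) := by
  have hW : 0 < ∫ x in (0 : ℝ)..π, sin x ^ r := integral_sin_pow_pos r
  have h : (∑ k ∈ Finset.range (n + 1), (n.choose (2 * k) : ℝ) * cosMoment r (2 * k)) *
      (2 * ∫ x in (0 : ℝ)..π, sin x ^ r) =
      (∫ x in (0 : ℝ)..π, (1 + 1 * cos x) ^ n * sin x ^ r) +
        ∫ x in (0 : ℝ)..π, (1 + (-1) * cos x) ^ n * sin x ^ r := by
    rw [← integral_add ((by fun_prop : Continuous _).intervalIntegrable _ _)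
      ((by fun_prop : Continuous _).intervalIntegrable _ _)]
    have h1 : ∀ x : ℝ, (1 + 1 * cos x) ^ n * sin x ^ r + (1 + (-1) * cos x) ^ n * sin x ^ r =
        ∑ k ∈ Finset.range (n + 1),
          (2 * (n.choose (2 * k) : ℝ)) * (cos x ^ (2 * k) * sin x ^ r) := by
      intro x
      have := add_pow_add_sub_pow 1 (cos x) n
      simp only [one_pow, one_mul] at this
      rw [← add_mul, one_mul, neg_one_mul, ← sub_eq_add_neg, this, Finset.mul_sum, Finset.sum_mul]
      exact Finset.sum_congr rfl fun k _ => by ring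
    simp only [h1]
    rw [intervalIntegral.integral_finsetSum fun k _ => (by fun_prop : Continuous _).intervalIntegrable _ _,
      Finset.sum_mul]
    refine Finset.sum_congr rfl fun k _ => ?_
    rw [intervalIntegral.integral_const_mul, cosMoment]
    field_simp
  refine mul_right_cancel₀ (b := 2 * ∫ x in (0 : ℝ)..π, sin x ^ r) (by positivity) ?_
  have h1 := integral_one_add_mul_cos_pow (e := 1) (by norm_num) r n
  have h2 := integral_one_add_mul_cos_pow (e := -1) (by norm_num) r n
  linear_combination (∏ k ∈ Finset.range n, (r + 1 + k : ℝ)) * h + h1 + h2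

/-- The zonal kernel of degree `n` as a function of `t = x · y`. -/
def zonalKernel (r n : ℕ) (t : ℝ) : ℝ :=
  ∑ k ∈ Finset.range (n + 1), (n.choose (2 * k) : ℝ) * cosMoment r (2 * k) * (-1) ^ k *
    (t ^ (n - 2 * k) * (1 - t ^ 2) ^ k)

/-- The Laplace integrand `t + i √(1 - t²) cos φ`. -/
def laplacePoint (t x : ℝ) : ℂ := ⟨t, √(1 - t ^ 2) * cos x⟩

lemma continuous_laplacePoint (t : ℝ) : Continuous (laplacePoint t) := by
  have : laplacePoint t = fun x : ℝ => (t : ℂ) + ((√(1 - t ^ 2) * cos x : ℝ) : ℂ) * Complex.I := by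
    funext x
    apply Complex.ext <;> simp [laplacePoint, -Complex.ofReal_cos]
  rw [this]
  fun_prop

lemma re_laplacePoint_pow {t : ℝ} (ht : t ^ 2 ≤ 1) (n : ℕ) (x : ℝ) :
    (laplacePoint t x ^ n).re = ∑ k ∈ Finset.range (n + 1), (n.choose (2 * k) : ℝ) * (-1) ^ k *
      (t ^ (n - 2 * k) * (1 - t ^ 2) ^ k) * cos x ^ (2 * k) := by
  have h1 : laplacePoint t x = (t : ℂ) + ((√(1 - t ^ 2) * cos x : ℝ) : ℂ) * Complex.I := by
    apply Complex.ext <;> simp [laplacePoint, -Complex.ofReal_cos]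
  have h2 : (starRingEnd ℂ) (laplacePoint t x) =
      (t : ℂ) - ((√(1 - t ^ 2) * cos x : ℝ) : ℂ) * Complex.I := by
    apply Complex.ext <;> simp [laplacePoint, -Complex.ofReal_cos]
  have h := add_pow_add_sub_pow (t : ℂ) (((√(1 - t ^ 2) * cos x : ℝ) : ℂ) * Complex.I) n
  rw [← h1, ← h2, ← map_pow, Complex.add_conj] at h
  have hk : ∀ k : ℕ, (((√(1 - t ^ 2) * cos x : ℝ) : ℂ) * Complex.I) ^ (2 * k) =
      (((-1) ^ k * (1 - t ^ 2) ^ k * cos x ^ (2 * k) : ℝ) : ℂ) := by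
    intro k
    rw [pow_mul, mul_pow, Complex.I_sq, ← Complex.ofReal_pow, mul_pow (√(1 - t ^ 2)),
      Real.sq_sqrt (by linarith), pow_mul (cos x)]
    push_cast
    simp only [mul_pow]
    ring
  have h3 : (((laplacePoint t x ^ n).re : ℝ) : ℂ) =
      ((∑ k ∈ Finset.range (n + 1), (n.choose (2 * k) : ℝ) * (-1) ^ k *
      (t ^ (n - 2 * k) * (1 - t ^ 2) ^ k) * cos x ^ (2 * k) : ℝ) : ℂ) := by
    refine mul_left_cancel₀ (two_ne_zero (α := ℂ)) ?_
    rw [← Complex.ofReal_ofNat, ← Complex.ofReal_mul, Complex.ofReal_ofNat, h]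
    simp only [hk]
    push_cast
    congr 1
    exact Finset.sum_congr rfl fun k _ => by ring
  exact_mod_cast h3

lemma zonalKernel_eq_integral {t : ℝ} (ht : t ^ 2 ≤ 1) (r n : ℕ) :
    zonalKernel r n t * ∫ x in (0 : ℝ)..π, sin x ^ r =
      ∫ x in (0 : ℝ)..π, (laplacePoint t x ^ n).re * sin x ^ r := by
  have hW : 0 < ∫ x in (0 : ℝ)..π, sin x ^ r := integral_sin_pow_pos r
  simp only [re_laplacePoint_pow ht, Finset.sum_mul, zonalKernel]
  rw [intervalIntegral.integral_finsetSum fun k _ => (by fun_prop : Continuous _).intervalIntegrable _ _]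
  refine Finset.sum_congr rfl fun k _ => ?_
  simp only [mul_assoc _ (cos _ ^ _)]
  rw [intervalIntegral.integral_const_mul, cosMoment]
  field_simp

lemma norm_laplacePoint_pow_le {t : ℝ} (ht : t ^ 2 ≤ 1) (n : ℕ) (x : ℝ) :
    ‖laplacePoint t x‖ ^ n ≤ exp (-(n / 2 * (1 - t ^ 2) * sin x ^ 2)) := by
  have hs : 0 ≤ 1 - t ^ 2 := by linarith
  have h : ‖laplacePoint t x‖ ^ 2 ≤ exp (-((1 - t ^ 2) * sin x ^ 2)) := by
    rw [← Complex.normSq_eq_norm_sq, Complex.normSq_apply]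
    have := add_one_le_exp (-((1 - t ^ 2) * sin x ^ 2))
    simp only [laplacePoint]
    have h2 := Real.mul_self_sqrt hs
    have h3 := sin_sq_add_cos_sq x
    have : t * t + √(1 - t ^ 2) * cos x * (√(1 - t ^ 2) * cos x) =
        -((1 - t ^ 2) * sin x ^ 2) + 1 := by
      linear_combination cos x ^ 2 * h2 + (1 - t ^ 2) * h3
    linarith
  have h2 : ‖laplacePoint t x‖ ≤ exp (-(1 / 2 * (1 - t ^ 2) * sin x ^ 2)) := by
    refine le_of_sq_le_sq ?_ (exp_pos _).le
    rw [← exp_nat_mul]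
    refine h.trans_eq (congrArg exp ?_)
    push_cast
    ring
  refine (pow_le_pow_left₀ (norm_nonneg _) h2 n).trans_eq ?_
  rw [← exp_nat_mul]
  refine congrArg exp ?_
  ring

lemma norm_one_sub_laplacePoint_sq_le {t : ℝ} (ht : t ^ 2 ≤ 1) (x : ℝ) :
    ‖1 - laplacePoint t x ^ 2‖ ≤ 4 * √(1 - t ^ 2) := by
  have h : 1 - laplacePoint t x ^ 2 = ((√(1 - t ^ 2) : ℝ) : ℂ) *
      (⟨√(1 - t ^ 2) * (1 + cos x ^ 2), -(2 * t * cos x)⟩ : ℂ) := by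
    apply Complex.ext
    · have hs := Real.mul_self_sqrt (by linarith : 0 ≤ 1 - t ^ 2)
      rw [pow_two] at hs
      simp only [pow_two, Complex.sub_re, Complex.one_re, Complex.mul_re, laplacePoint,
        Complex.ofReal_re, Complex.ofReal_im, zero_mul, sub_zero]
      linear_combination -hs
    · simp [laplacePoint, pow_two]
      ring
  have hs1 : √(1 - t ^ 2) ≤ 1 := Real.sqrt_le_one.2 (by nlinarith)
  have hc := cos_sq_le_one x
  have ht' : |t| ≤ 1 := by rwa [← sq_le_one_iff_abs_le_one]
  have hc' := abs_cos_le_one x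
  rw [h, norm_mul, Complex.norm_real, Real.norm_of_nonneg (Real.sqrt_nonneg _), mul_comm]
  refine mul_le_mul_of_nonneg_right ((Complex.norm_le_abs_re_add_abs_im _).trans ?_)
    (Real.sqrt_nonneg _)
  simp only [abs_neg, abs_mul, abs_two]
  rw [abs_of_nonneg (Real.sqrt_nonneg _), abs_of_nonneg (by positivity)]
  have h1 : √(1 - t ^ 2) * (1 + cos x ^ 2) ≤ 1 * 2 :=
    mul_le_mul hs1 (by linarith) (by positivity) (by norm_num)
  have h2 : |t| * |cos x| ≤ 1 := mul_le_one₀ ht' (abs_nonneg _) hc'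
  nlinarith

/-- The alternating sum of zonal kernels which is the kernel of the operator `Tconv`. -/
def diffKernel (r n : ℕ) (t : ℝ) : ℝ :=
  ∑ j ∈ Finset.range (r + 2), (-1 : ℝ) ^ j * ((r + 1).choose j : ℝ) * zonalKernel r (n + 2 * j) t

lemma diffKernel_eq_integral {t : ℝ} (ht : t ^ 2 ≤ 1) (r n : ℕ) :
    diffKernel r n t * ∫ x in (0 : ℝ)..π, sin x ^ r =
      ∫ x in (0 : ℝ)..π,
        (laplacePoint t x ^ n * (1 - laplacePoint t x ^ 2) ^ (r + 1)).re * sin x ^ r := by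
  have hc := continuous_laplacePoint t
  have hcont : ∀ k, Continuous fun x => (laplacePoint t x ^ k).re * sin x ^ r := fun k =>
    (Complex.continuous_re.comp (hc.pow k)).mul (by fun_prop)
  have h : ∀ x : ℝ,
      (laplacePoint t x ^ n * (1 - laplacePoint t x ^ 2) ^ (r + 1)).re * sin x ^ r =
      ∑ j ∈ Finset.range (r + 2), ((-1 : ℝ) ^ j * ((r + 1).choose j : ℝ)) *
        ((laplacePoint t x ^ (n + 2 * j)).re * sin x ^ r) := by
    intro x
    set ω := laplacePoint t x
    have : ω ^ n * (1 - ω ^ 2) ^ (r + 1) = ∑ j ∈ Finset.range (r + 2),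
        (((-1 : ℝ) ^ j * ((r + 1).choose j : ℝ) : ℝ) : ℂ) * ω ^ (n + 2 * j) := by
      rw [sub_eq_neg_add, add_pow, Finset.mul_sum]
      refine Finset.sum_congr rfl fun j _ => ?_
      rw [neg_pow, one_pow]
      push_cast
      ring
    rw [this, Complex.re_sum, Finset.sum_mul]
    refine Finset.sum_congr rfl fun j _ => ?_
    rw [Complex.re_ofReal_mul]
    ring
  simp only [h]
  rw [intervalIntegral.integral_finsetSum fun k _ => ((hcont _).const_mul _).intervalIntegrable _ _, diffKernel,
    Finset.sum_mul]
  refine Finset.sum_congr rfl fun j _ => ?_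
  rw [intervalIntegral.integral_const_mul, mul_assoc, zonalKernel_eq_integral ht]

end ZonalKernel

section KernelBound

open Real

lemma integral_pow_mul_exp_neg_mul_sq {b : ℝ} (hb : 0 < b) (r : ℕ) :
    ∫ x in Set.Ioi (0 : ℝ), x ^ r * exp (-b * x ^ 2) =
      b ^ (-((r : ℝ) + 1) / 2) * (1 / 2 * Gamma (((r : ℝ) + 1) / 2)) := by
  have h := integral_rpow_mul_exp_neg_mul_rpow (p := 2) (q := r) (b := b) (by norm_num)
    (by have : (0 : ℝ) ≤ r := r.cast_nonneg
        linarith) hb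
  rw [← mul_assoc, ← h]
  simp only [rpow_natCast, rpow_ofNat]

lemma integrableOn_pow_mul_exp_neg_mul_sq {b : ℝ} (hb : 0 < b) (r : ℕ) :
    IntegrableOn (fun x : ℝ => x ^ r * exp (-b * x ^ 2)) (Set.Ioi 0) := by
  have h := integrableOn_rpow_mul_exp_neg_mul_rpow (p := 2) (s := r) (b := b)
    (by have : (0 : ℝ) ≤ r := r.cast_nonneg
        linarith) (by norm_num) hb
  simpa only [rpow_natCast, rpow_ofNat] using h

lemma exp_neg_mul_sin_sq_mul_sin_pow_le_of_le {a x : ℝ} (ha : 0 ≤ a) (hx : 0 ≤ x)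
    (hx' : x ≤ π / 2) (r : ℕ) :
    exp (-(a * sin x ^ 2)) * sin x ^ r ≤ x ^ r * exp (-(a * (2 / π) ^ 2) * x ^ 2) := by
  have h0 : 0 ≤ sin x := sin_nonneg_of_nonneg_of_le_pi hx (by linarith [pi_pos])
  have h1 : 2 / π * x ≤ sin x := mul_le_sin hx hx'
  have h2 : sin x ≤ x := sin_le hx
  rw [mul_comm]
  refine mul_le_mul (pow_le_pow_left₀ h0 h2 r) (exp_le_exp.2 ?_) (exp_pos _).le (by positivity)
  have : (2 / π * x) ^ 2 ≤ sin x ^ 2 := pow_le_pow_left₀ (by positivity) h1 2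
  have := mul_le_mul_of_nonneg_left this ha
  linarith [show a * (2 / π * x) ^ 2 = a * (2 / π) ^ 2 * x ^ 2 by ring]

lemma integral_exp_neg_mul_sin_sq_mul_sin_pow_le {a : ℝ} (ha : 0 < a) (r : ℕ) :
    ∫ x in (0 : ℝ)..π, exp (-(a * sin x ^ 2)) * sin x ^ r ≤
      (a * (2 / π) ^ 2) ^ (-((r : ℝ) + 1) / 2) * Gamma (((r : ℝ) + 1) / 2) := by
  have hb : 0 < a * (2 / π) ^ 2 := by positivity
  set b := a * (2 / π) ^ 2
  let h : ℝ → ℝ := fun x => x ^ r * exp (-b * x ^ 2)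
  have hh : Continuous h := by fun_prop
  have h0 : ∀ x, 0 ≤ x → 0 ≤ h x := fun x hx => by positivity
  have hle : ∀ x ∈ Set.Icc (0 : ℝ) π, exp (-(a * sin x ^ 2)) * sin x ^ r ≤ h x + h (π - x) := by
    intro x hx
    rcases le_total x (π / 2) with hx' | hx'
    · exact (exp_neg_mul_sin_sq_mul_sin_pow_le_of_le ha.le hx.1 hx' r).trans
        (le_add_of_nonneg_right (h0 _ (by linarith [hx.2])))
    · have := exp_neg_mul_sin_sq_mul_sin_pow_le_of_le ha.le (x := π - x) (by linarith [hx.2])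
        (by linarith) r
      rw [sin_pi_sub] at this
      exact this.trans (le_add_of_nonneg_left (h0 _ hx.1))
  have h1 : ∫ x in (0 : ℝ)..π, h x ≤ ∫ x in Set.Ioi (0 : ℝ), h x := by
    rw [intervalIntegral.integral_of_le pi_pos.le]
    exact setIntegral_mono_set (integrableOn_pow_mul_exp_neg_mul_sq hb r)
      ((ae_restrict_iff' measurableSet_Ioi).2 (.of_forall fun x hx => h0 x (le_of_lt hx)))
      Set.Ioc_subset_Ioi_self.eventuallyLE
  have h2 : ∫ x in (0 : ℝ)..π, h (π - x) = ∫ x in (0 : ℝ)..π, h x := by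
    rw [intervalIntegral.integral_comp_sub_left]
    simp
  have h3 := intervalIntegral.integral_mono_on (μ := volume) pi_pos.le
    ((by fun_prop : Continuous fun x => exp (-(a * sin x ^ 2)) * sin x ^ r).intervalIntegrable _ _)
    ((hh.add (hh.comp (continuous_sub_left π))).intervalIntegrable 0 π) hle
  rw [integral_pow_mul_exp_neg_mul_sq hb] at h1
  refine h3.trans ?_
  have h4 : ∫ x in (0 : ℝ)..π, (h + h ∘ fun x => π - x) x =
      (∫ x in (0 : ℝ)..π, h x) + ∫ x in (0 : ℝ)..π, h (π - x) :=
    intervalIntegral.integral_add (hh.intervalIntegrable _ _)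
      ((hh.comp (continuous_sub_left π)).intervalIntegrable _ _)
  refine h4.le.trans ?_
  rw [h2]
  linarith

/-- A uniform bound for the difference kernel with the decay of order `n ^ (-(d - 2) / 2)`. -/
theorem exists_abs_diffKernel_le (r : ℕ) : ∃ C : ℝ, 0 < C ∧ ∀ n : ℕ, 1 ≤ n → ∀ t : ℝ,
    t ^ 2 ≤ 1 → |diffKernel r n t| ≤ C * (n : ℝ) ^ (-((r : ℝ) + 1) / 2) := by
  have hW : 0 < ∫ x in (0 : ℝ)..π, sin x ^ r := integral_sin_pow_pos r
  have hG : 0 < Gamma (((r : ℝ) + 1) / 2) := Gamma_pos_of_pos (by positivity)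
  refine ⟨4 ^ (r + 1) * ((1 / 2 * (2 / π) ^ 2) ^ (-((r : ℝ) + 1) / 2) *
    Gamma (((r : ℝ) + 1) / 2)) / ∫ x in (0 : ℝ)..π, sin x ^ r, by positivity,
    fun n hn t ht => ?_⟩
  rw [div_mul_eq_mul_div, le_div_iff₀ hW, ← abs_of_pos hW, ← abs_mul, diffKernel_eq_integral ht]
  have hn0 : (0 : ℝ) < n := by exact_mod_cast hn
  have hs : 0 ≤ 1 - t ^ 2 := by linarith
  have hbound : ∀ x ∈ Set.Icc (0 : ℝ) π,
      ‖(laplacePoint t x ^ n * (1 - laplacePoint t x ^ 2) ^ (r + 1)).re * sin x ^ r‖ ≤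
      (4 * √(1 - t ^ 2)) ^ (r + 1) *
        (exp (-((n / 2 * (1 - t ^ 2)) * sin x ^ 2)) * sin x ^ r) := by
    intro x hx
    have hsin : 0 ≤ sin x ^ r := pow_nonneg (sin_nonneg_of_mem_Icc hx) r
    rw [norm_mul, Real.norm_of_nonneg hsin, ← mul_assoc]
    refine mul_le_mul_of_nonneg_right ((Complex.abs_re_le_norm _).trans ?_) hsin
    rw [norm_mul, norm_pow, norm_pow, mul_comm]
    exact mul_le_mul (pow_le_pow_left₀ (norm_nonneg _) (norm_one_sub_laplacePoint_sq_le ht x) _)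
      (norm_laplacePoint_pow_le ht n x) (by positivity) (by positivity)
  have h1 : |∫ x in (0 : ℝ)..π,
      (laplacePoint t x ^ n * (1 - laplacePoint t x ^ 2) ^ (r + 1)).re * sin x ^ r| ≤
      (4 * √(1 - t ^ 2)) ^ (r + 1) * ∫ x in (0 : ℝ)..π,
        exp (-((n / 2 * (1 - t ^ 2)) * sin x ^ 2)) * sin x ^ r := by
    rw [← intervalIntegral.integral_const_mul]
    exact intervalIntegral.norm_integral_le_of_norm_le pi_pos.le
      (.of_forall fun x hx => hbound x ⟨hx.1.le, hx.2⟩)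
      ((by fun_prop : Continuous _).intervalIntegrable _ _)
  refine h1.trans ?_
  rcases hs.eq_or_lt with hs0 | hs0
  · rw [← hs0]
    simp only [sqrt_zero, mul_zero, zero_pow (Nat.succ_ne_zero r), zero_mul]
    positivity
  · have h2 := integral_exp_neg_mul_sin_sq_mul_sin_pow_le
      (a := n / 2 * (1 - t ^ 2)) (by positivity) r
    refine (mul_le_mul_of_nonneg_left h2 (by positivity)).trans_eq ?_
    have h3 : √(1 - t ^ 2) ^ (r + 1) * (1 - t ^ 2) ^ (-((r : ℝ) + 1) / 2) = 1 := by
      rw [sqrt_eq_rpow, ← rpow_natCast, ← rpow_mul hs, ← rpow_add hs0]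
      push_cast
      rw [show 1 / 2 * ((r : ℝ) + 1) + -((r : ℝ) + 1) / 2 = 0 by ring, rpow_zero]
    rw [show n / 2 * (1 - t ^ 2) * (2 / π) ^ 2 = (1 / 2 * (2 / π) ^ 2) * (1 - t ^ 2) * n by ring,
      mul_rpow (by positivity) hn0.le, mul_rpow (by positivity) hs, mul_pow]
    linear_combination (4 ^ (r + 1) * ((1 / 2 * (2 / π) ^ 2) ^ (-((r : ℝ) + 1) / 2) *
      Gamma (((r : ℝ) + 1) / 2)) * (n : ℝ) ^ (-((r : ℝ) + 1) / 2)) * h3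

end KernelBound

section Interpolation

open Real

variable {α : Type*} [MeasurableSpace α] {μ : Measure α}

lemma lintegral_ofReal_sq_eq_norm_sq (h : Lp ℝ 2 μ) :
    ∫⁻ x, ENNReal.ofReal (h x ^ 2) ∂μ = ENNReal.ofReal (‖h‖ ^ 2) := by
  rw [← ofReal_integral_eq_lintegral_ofReal (Lp.memLp h).integrable_sq
    (.of_forall fun x => sq_nonneg _), ← real_inner_self_eq_norm_sq, L2.inner_def]
  simp [pow_two]

variable [IsFiniteMeasure μ]

lemma integrable_abs_rpow (f : Lp ℝ 2 μ) {q : ℝ} (hq0 : 0 < q) (hq : q ≤ 2) :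
    Integrable (fun x => |f x| ^ q) μ := by
  have h : MemLp f (ENNReal.ofReal q) μ := (Lp.memLp f).mono_exponent (by
    rw [← ENNReal.ofReal_ofNat]; exact ENNReal.ofReal_le_ofReal hq)
  have := h.integrable_norm_rpow (by simpa using hq0) (by simp)
  simpa [ENNReal.toReal_ofReal hq0.le] using this

lemma measure_lt_abs_le {T : Lp ℝ 2 μ → Lp ℝ 2 μ} (hadd : ∀ f g, T (f + g) = T f + T g)
    {A B : ℝ} (hT2 : ∀ f, ‖T f‖ ≤ B * ‖f‖)
    (hA : 0 ≤ A) (hT1 : ∀ f, ∀ᵐ x ∂μ, |T f x| ≤ A * ∫ y, |f y| ∂μ)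
    (f : Lp ℝ 2 μ) {q : ℝ} (hq1 : 1 < q) (hq2 : q ≤ 2) {l s : ℝ} (hl : 0 < l) (hs : 0 < s)
    (hls : A * (s ^ (1 - q) * ∫ y, |f y| ^ q ∂μ) ≤ l / 2) :
    μ {x | l < |T f x|} ≤ ENNReal.ofReal (4 * B ^ 2 / l ^ 2) *
      ∫⁻ x, {x | |f x| ≤ s}.indicator (fun x => ENNReal.ofReal (f x ^ 2)) x ∂μ := by
  have hfm : Measurable (f : α → ℝ) := (Lp.stronglyMeasurable f).measurable
  have hS : MeasurableSet {x | |f x| ≤ s} := measurableSet_le hfm.abs measurable_const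
  have m1 := (Lp.memLp f).indicator hS.compl
  have m2 := (Lp.memLp f).indicator hS
  have hf : f = m1.toLp _ + m2.toLp _ := by
    rw [← MemLp.toLp_add]
    refine Lp.ext ?_
    filter_upwards [MemLp.coeFn_toLp (m1.add m2)] with x hx
    rw [hx, Set.indicator_compl_add_self]
  have h1 : ∀ᵐ x ∂μ, |T (m1.toLp _) x| ≤ l / 2 := by
    filter_upwards [hT1 (m1.toLp _)] with x hx
    refine hx.trans (le_trans (mul_le_mul_of_nonneg_left ?_ hA) hls)
    rw [← integral_const_mul]
    refine integral_mono_ae ((Lp.memLp _).integrable (by norm_num)).abs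
      ((integrable_abs_rpow f (by linarith) hq2).const_mul _) ?_
    filter_upwards [m1.coeFn_toLp] with y hy
    simp only [hy]
    by_cases h : |f y| ≤ s
    · rw [Set.indicator_of_notMem (by simpa using h), abs_zero]
      positivity
    · rw [Set.indicator_of_mem (by simpa using h)]
      have h' : s < |f y| := not_le.1 h
      have h0 : 0 < |f y| := hs.trans h'
      calc |f y| = |f y| ^ (1 - q) * |f y| ^ q := by
            rw [← rpow_add h0]; simp
        _ ≤ s ^ (1 - q) * |f y| ^ q := by
            refine mul_le_mul_of_nonneg_right ?_ (by positivity)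
            exact rpow_le_rpow_of_nonpos hs h'.le (by linarith)
  have h2 : ∀ᵐ x ∂μ, l < |T f x| → ENNReal.ofReal (l ^ 2 / 4) ≤
      ENNReal.ofReal (T (m2.toLp _) x ^ 2) := by
    have e : T f = T (m1.toLp _) + T (m2.toLp _) := by rw [← hadd, ← hf]
    filter_upwards [h1, Lp.coeFn_add (T (m1.toLp _)) (T (m2.toLp _))] with x hx1 hx2 hx
    rw [e, hx2, Pi.add_apply] at hx
    have h3 := abs_add_le (T (m1.toLp _) x) (T (m2.toLp _) x)
    have h4 : l / 2 ≤ |T (m2.toLp _) x| := by linarith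
    refine ENNReal.ofReal_le_ofReal ?_
    rw [← sq_abs (T (m2.toLp _) x)]
    nlinarith
  have h3 : ENNReal.ofReal (l ^ 2 / 4) * μ {x | l < |T f x|} ≤
      ENNReal.ofReal (B ^ 2) *
        ∫⁻ x, {x | |f x| ≤ s}.indicator (fun x => ENNReal.ofReal (f x ^ 2)) x ∂μ := by
    calc ENNReal.ofReal (l ^ 2 / 4) * μ {x | l < |T f x|}
        ≤ ENNReal.ofReal (l ^ 2 / 4) *
          μ {x | ENNReal.ofReal (l ^ 2 / 4) ≤ ENNReal.ofReal (T (m2.toLp _) x ^ 2)} :=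
          mul_le_mul_right (measure_mono_ae h2) _
      _ ≤ ∫⁻ x, ENNReal.ofReal (T (m2.toLp _) x ^ 2) ∂μ :=
          mul_meas_ge_le_lintegral
            ((Lp.stronglyMeasurable _).measurable.pow_const 2).ennreal_ofReal _
      _ = ENNReal.ofReal (‖T (m2.toLp _)‖ ^ 2) := lintegral_ofReal_sq_eq_norm_sq _
      _ ≤ ENNReal.ofReal ((B * ‖m2.toLp _‖) ^ 2) :=
          ENNReal.ofReal_le_ofReal (pow_le_pow_left₀ (norm_nonneg _) (hT2 _) 2)
      _ = ENNReal.ofReal (B ^ 2) * ∫⁻ x, ENNReal.ofReal (m2.toLp _ x ^ 2) ∂μ := by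
          rw [lintegral_ofReal_sq_eq_norm_sq, mul_pow, ENNReal.ofReal_mul (sq_nonneg _)]
      _ = _ := by
          congr 1
          refine lintegral_congr_ae ?_
          filter_upwards [m2.coeFn_toLp] with x hx
          rw [hx]
          by_cases h : x ∈ {x | |f x| ≤ s}
          · rw [Set.indicator_of_mem h, Set.indicator_of_mem h]
          · rw [Set.indicator_of_notMem h, Set.indicator_of_notMem h]
            simp
  have h4 := mul_le_mul_right h3 (ENNReal.ofReal (4 / l ^ 2))
  rw [← mul_assoc, ← mul_assoc, ← ENNReal.ofReal_mul (by positivity),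
    ← ENNReal.ofReal_mul (by positivity),
    show 4 / l ^ 2 * (l ^ 2 / 4) = 1 by field_simp, ENNReal.ofReal_one, one_mul,
    div_mul_eq_mul_div] at h4
  exact h4

lemma lintegral_rpow_sub_three_le {M a : ℝ} (hM : 0 ≤ M) (ha : 2 < a) :
    ∫⁻ l in Set.Ioc 0 M, ENNReal.ofReal (l ^ (a - 3)) ≤
      ENNReal.ofReal (M ^ (a - 2) / (a - 2)) := by
  have hint : IntegrableOn (fun l : ℝ => l ^ (a - 3)) (Set.Ioc 0 M) := by
    have := intervalIntegral.intervalIntegrable_rpow' (a := 0) (b := M) (r := a - 3) (by linarith)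
    rwa [intervalIntegrable_iff_integrableOn_Ioc_of_le hM] at this
  rw [← ofReal_integral_eq_lintegral_ofReal hint
    ((ae_restrict_iff' measurableSet_Ioc).2 (.of_forall fun x hx => rpow_nonneg hx.1.le _)),
    ← intervalIntegral.integral_of_le hM, integral_rpow (Or.inl (by linarith))]
  rw [show a - 3 + 1 = a - 2 by ring, zero_rpow (by linarith), sub_zero]

end Interpolation

section InterpolationBound

open Real

variable {α : Type*} [MeasurableSpace α] {μ : Measure α} [IsFiniteMeasure μ]

lemma lintegral_abs_rpow_le {T : Lp ℝ 2 μ → Lp ℝ 2 μ} (hadd : ∀ f g, T (f + g) = T f + T g)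
    {A B : ℝ} (hT2 : ∀ f, ‖T f‖ ≤ B * ‖f‖)
    (hA : 0 < A) (hT1 : ∀ f, ∀ᵐ x ∂μ, |T f x| ≤ A * ∫ y, |f y| ∂μ)
    (f : Lp ℝ 2 μ) {q a : ℝ} (hq1 : 1 < q) (hq2 : q ≤ 2) (ha : 2 < a) (hqa : (q - 1) * a = q)
    {N : ℝ} (hN : 0 < N) (hNf : ∫ y, |f y| ^ q ∂μ = N) :
    ∫⁻ x, ENNReal.ofReal (|T f x| ^ a) ∂μ ≤
      ENNReal.ofReal (4 * B ^ 2 * a / (a - 2) * (2 * A) ^ (a - 2) * N ^ (a - 1)) := by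
  have hfm : Measurable (f : α → ℝ) := (Lp.stronglyMeasurable f).measurable
  have hTfm : Measurable (T f : α → ℝ) := (Lp.stronglyMeasurable _).measurable
  let s : ℝ → ℝ := fun l => (2 * A * N / l) ^ (1 / (q - 1))
  have hsm : Measurable s := by fun_prop
  let S : Set (ℝ × α) := {z | |f z.2| ≤ s z.1}
  have hSm : MeasurableSet S :=
    measurableSet_le (hfm.comp measurable_snd).abs (hsm.comp measurable_fst)
  let G : ℝ → α → ℝ≥0∞ := fun l x =>
    S.indicator (fun z => ENNReal.ofReal (z.1 ^ (a - 3)) * ENNReal.ofReal (f z.2 ^ 2)) (l, x)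
  have hGm : Measurable (Function.uncurry G) := by
    refine Measurable.indicator ?_ hSm
    exact (measurable_fst.pow_const _).ennreal_ofReal.mul
      ((hfm.comp measurable_snd).pow_const 2).ennreal_ofReal
  have hweak : ∀ l ∈ Set.Ioi (0 : ℝ), μ {x | l < |T f x|} * ENNReal.ofReal (l ^ (a - 1)) ≤
      ENNReal.ofReal (4 * B ^ 2) * ∫⁻ x, G l x ∂μ := by
    intro l hl
    have hl : 0 < l := hl
    have hpos : 0 < 2 * A * N / l := by positivity
    have h := measure_lt_abs_le hadd hT2 hA.le hT1 f hq1 hq2 hl (s := s l) (by positivity) (by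
      have hq0 : q - 1 ≠ 0 := by linarith
      rw [← rpow_mul hpos.le, show 1 / (q - 1) * (1 - q) = -1 by field_simp; ring,
        rpow_neg_one, hNf]
      refine le_of_eq ?_
      field_simp)
    refine (mul_le_mul_left h _).trans_eq ?_
    rw [← lintegral_const_mul _ (hGm.of_uncurry_left), mul_right_comm, ← ENNReal.ofReal_mul
      (by positivity), show 4 * B ^ 2 / l ^ 2 * l ^ (a - 1) = 4 * B ^ 2 * l ^ (a - 3) by
        rw [show a - 1 = a - 3 + 2 by ring, rpow_add hl, rpow_ofNat]
        field_simp, ← lintegral_const_mul _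
      ((hfm.pow_const 2).ennreal_ofReal.indicator (measurableSet_le hfm.abs measurable_const))]
    refine lintegral_congr fun x => ?_
    by_cases hx : |f x| ≤ s l
    · rw [Set.indicator_of_mem (show x ∈ {a | |f a| ≤ s l} from hx), ENNReal.ofReal_mul (by positivity), mul_assoc]
      simp only [G]
      rw [Set.indicator_of_mem (show (l, x) ∈ S from hx)]
    · rw [Set.indicator_of_notMem (show x ∉ {a | |f a| ≤ s l} from hx)]
      simp only [G]
      rw [Set.indicator_of_notMem (show (l, x) ∉ S from hx)]
      simp
  have hinner : ∀ x, ∫⁻ l in Set.Ioi (0 : ℝ), G l x ≤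
      ENNReal.ofReal ((2 * A * N) ^ (a - 2) / (a - 2) * |f x| ^ q) := by
    intro x
    rcases eq_or_ne (f x) 0 with h0 | h0
    · have : ∀ l, G l x = 0 := fun l => Set.indicator_apply_eq_zero.2 fun _ => by simp [h0]
      simp [this]
    have hf0 : 0 < |f x| := abs_pos.2 h0
    set M := 2 * A * N * |f x| ^ (1 - q) with hM
    have hM0 : 0 < M := by positivity
    calc ∫⁻ l in Set.Ioi (0 : ℝ), G l x
        ≤ ∫⁻ l in Set.Ioi (0 : ℝ), (Set.Ioc 0 M).indicator
          (fun l => ENNReal.ofReal (l ^ (a - 3))) l * ENNReal.ofReal (f x ^ 2) := by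
          refine setLIntegral_mono' measurableSet_Ioi fun l hl => ?_
          have hl : 0 < l := hl
          by_cases hx : |f x| ≤ s l
          · have hlM : l ≤ M := by
              have h1 : |f x| ^ (q - 1) ≤ 2 * A * N / l := by
                refine (rpow_le_rpow hf0.le hx (by linarith)).trans_eq ?_
                have hq0 : q - 1 ≠ 0 := by linarith
                rw [← rpow_mul (by positivity), one_div_mul_cancel hq0, rpow_one]
              rw [le_div_iff₀ hl] at h1
              rw [hM, show 1 - q = -(q - 1) by ring, rpow_neg hf0.le, ← div_eq_mul_inv,
                le_div_iff₀ (by positivity)]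
              linarith
            rw [Set.indicator_of_mem (show l ∈ Set.Ioc 0 M from ⟨hl, hlM⟩)]
            simp only [G]
            rw [Set.indicator_of_mem (show (l, x) ∈ S from hx)]
          · simp only [G]
            rw [Set.indicator_of_notMem (show (l, x) ∉ S from hx)]
            exact zero_le
      _ = (∫⁻ l in Set.Ioc 0 M, ENNReal.ofReal (l ^ (a - 3))) * ENNReal.ofReal (f x ^ 2) := by
          rw [lintegral_mul_const _ (Measurable.indicator
            (by fun_prop) measurableSet_Ioc), lintegral_indicator measurableSet_Ioc,
            Measure.restrict_restrict measurableSet_Ioc,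
            Set.inter_eq_left.2 Set.Ioc_subset_Ioi_self]
      _ ≤ ENNReal.ofReal (M ^ (a - 2) / (a - 2)) * ENNReal.ofReal (f x ^ 2) :=
          mul_le_mul_left (lintegral_rpow_sub_three_le hM0.le ha) _
      _ = _ := by
          have ha' : 0 < a - 2 := by linarith
          rw [← ENNReal.ofReal_mul (by positivity)]
          congr 1
          rw [hM, mul_rpow (by positivity) (by positivity), ← rpow_mul hf0.le, ← sq_abs,
            ← rpow_ofNat, div_mul_eq_mul_div, mul_assoc, ← rpow_add hf0, div_mul_eq_mul_div,
            show (1 - q) * (a - 2) + 2 = q by linarith]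
  rw [lintegral_rpow_eq_lintegral_meas_lt_mul μ (.of_forall fun x => abs_nonneg _)
    hTfm.abs.aemeasurable (by linarith)]
  have ha' : 0 < a - 2 := by linarith
  calc ENNReal.ofReal a * ∫⁻ l in Set.Ioi 0, μ {x | l < |T f x|} * ENNReal.ofReal (l ^ (a - 1))
      ≤ ENNReal.ofReal a * ∫⁻ l in Set.Ioi 0, ENNReal.ofReal (4 * B ^ 2) * ∫⁻ x, G l x ∂μ :=
        mul_le_mul_right (setLIntegral_mono' measurableSet_Ioi hweak) _
    _ = ENNReal.ofReal a * (ENNReal.ofReal (4 * B ^ 2) *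
        ∫⁻ x, (∫⁻ l in Set.Ioi (0 : ℝ), G l x) ∂μ) := by
        rw [lintegral_const_mul _
          (show Measurable fun l => ∫⁻ x, G l x ∂μ from hGm.lintegral_prod_right'),
          lintegral_lintegral_swap hGm.aemeasurable]
    _ ≤ ENNReal.ofReal a * (ENNReal.ofReal (4 * B ^ 2) *
        ∫⁻ x, ENNReal.ofReal ((2 * A * N) ^ (a - 2) / (a - 2) * |f x| ^ q) ∂μ) :=
        mul_le_mul_right (mul_le_mul_right (lintegral_mono hinner) _) _
    _ = _ := by
        rw [← ofReal_integral_eq_lintegral_ofReal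
          ((integrable_abs_rpow f (by linarith) hq2).const_mul _)
          (.of_forall fun x => by positivity), integral_const_mul, hNf,
          ← ENNReal.ofReal_mul (by positivity), ← ENNReal.ofReal_mul (by linarith)]
        congr 1
        rw [mul_rpow (by positivity) hN.le, show a - 1 = a - 2 + 1 by ring, rpow_add_one hN.ne']
        ring

end InterpolationBound

section InterpolationNorm

open Real

variable {α : Type*} [MeasurableSpace α] {μ : Measure α}

lemma eLpNorm_eq_lintegral_ofReal_abs_rpow {p : ℝ≥0∞} (hp0 : p ≠ 0) (hp : p ≠ ∞) (f : α → ℝ) :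
    eLpNorm f p μ =
      (∫⁻ x, ENNReal.ofReal (|f x| ^ p.toReal) ∂μ) ^ (1 / p.toReal) := by
  rw [eLpNorm_eq_lintegral_rpow_enorm_toReal hp0 hp]
  simp only [Real.enorm_eq_ofReal_abs,
    ENNReal.ofReal_rpow_of_nonneg (abs_nonneg _) (ENNReal.toReal_nonneg (a := p))]

lemma eLpNorm_eq_ofReal_integral_abs_rpow [IsFiniteMeasure μ] {p : ℝ≥0∞} (hp0 : p ≠ 0) (hp : p ≤ 2)
    (f : Lp ℝ 2 μ) :
    eLpNorm f p μ = ENNReal.ofReal ((∫ x, |f x| ^ p.toReal ∂μ) ^ (1 / p.toReal)) := by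
  have hpt : p ≠ ∞ := (hp.trans_lt (by simp)).ne
  have h0 : 0 < p.toReal := ENNReal.toReal_pos hp0 hpt
  rw [eLpNorm_eq_lintegral_ofReal_abs_rpow hp0 hpt, ← ofReal_integral_eq_lintegral_ofReal
    (integrable_abs_rpow f h0 (by simpa using ENNReal.toReal_mono (by simp) hp))
    (.of_forall fun x => by positivity),
    ENNReal.ofReal_rpow_of_nonneg (integral_nonneg fun x => by positivity) (by positivity)]

/-- Interpolation between an `L² → L²` and an `L¹ → L^∞` bound. -/
theorem exists_eLpNorm_conjugate_le (μ : Measure α) [IsFiniteMeasure μ] {p p' : ℝ≥0∞}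
    (hp1 : 1 ≤ p) (hp2 : p ≤ 2) (hpp' : 1 / p + 1 / p' = 1) {B : ℝ} (hB : 0 < B) :
    ∃ C : ℝ, 0 < C ∧ ∀ T : Lp ℝ 2 μ → Lp ℝ 2 μ, (∀ f g, T (f + g) = T f + T g) →
      (∀ f, ‖T f‖ ≤ B * ‖f‖) → ∀ A : ℝ, 0 < A →
      (∀ f, ∀ᵐ x ∂μ, |T f x| ≤ A * ∫ y, |f y| ∂μ) → ∀ f : Lp ℝ 2 μ,
      eLpNorm (T f) p' μ ≤ ENNReal.ofReal (C * A ^ (2 / p.toReal - 1)) * eLpNorm f p μ := by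
  have hp0 : p ≠ 0 := (zero_lt_one.trans_le hp1).ne'
  rcases hp1.eq_or_lt with rfl | hp1
  · have hp' : p' = ∞ := by
      have : 1 / p' = 0 := by
        rw [div_one] at hpp'
        exact (ENNReal.add_right_inj ENNReal.one_ne_top).1 (hpp'.trans (add_zero 1).symm)
      simpa using this
    subst hp'
    refine ⟨1, one_pos, fun T _ _ A hA hT1 f => ?_⟩
    rw [eLpNorm_eq_ofReal_integral_abs_rpow one_ne_zero hp2 f, ← ENNReal.ofReal_mul (by positivity)]
    rw [eLpNorm_exponent_top]
    refine eLpNormEssSup_le_of_ae_bound ?_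
    filter_upwards [hT1 f] with x hx
    norm_num
    exact hx
  rcases hp2.eq_or_lt with rfl | hp2
  · have hp' : p' = 2 := by
      have h : (2 : ℝ≥0∞)⁻¹ + p'⁻¹ = 2⁻¹ + 2⁻¹ := by
        rw [ENNReal.inv_two_add_inv_two]; simpa using hpp'
      have := (ENNReal.add_right_inj (by simp)).1 h
      exact inv_injective this
    subst hp'
    refine ⟨B, hB, fun T _ hT2 A _ _ f => ?_⟩
    have h2 : (2 : ℝ) / (2 : ℝ≥0∞).toReal - 1 = 0 := by norm_num
    rw [h2, rpow_zero, mul_one, ← ENNReal.ofReal_toReal (Lp.eLpNorm_ne_top f),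
      ← ENNReal.ofReal_toReal (Lp.eLpNorm_ne_top (T f)), ← Lp.norm_def, ← Lp.norm_def,
      ← ENNReal.ofReal_mul hB.le]
    exact ENNReal.ofReal_le_ofReal (hT2 f)
  have hpt : p ≠ ∞ := (hp2.trans (by simp)).ne
  have hp'0 : p' ≠ 0 := by
    rintro rfl
    simp at hpp'
  have hp't : p' ≠ ∞ := by
    rintro rfl
    simp at hpp'
    exact hp1.ne' hpp'
  set q := p.toReal with hq
  set a := p'.toReal with ha
  have hq1 : 1 < q := by simpa using (ENNReal.toReal_lt_toReal (by simp) hpt).2 hp1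
  have hq2 : q < 2 := by simpa using (ENNReal.toReal_lt_toReal hpt (by simp)).2 hp2
  have ha0 : 0 < a := ENNReal.toReal_pos hp'0 hp't
  have hconj : 1 / q + 1 / a = 1 := by
    have := congrArg ENNReal.toReal hpp'
    rw [ENNReal.toReal_add (by simpa using hp0) (by simpa using hp'0)] at this
    simpa using this
  have hqa : (q - 1) * a = q := by
    have : q ≠ 0 := by linarith
    field_simp at hconj
    linarith
  have ha2 : 2 < a := by nlinarith
  have ha2' : 0 < a - 2 := by linarith
  have e1 : (a - 2) * (1 / a) = 2 / q - 1 := by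
    have : 1 / q = 1 - 1 / a := by linarith
    rw [show 2 / q = 2 * (1 / q) by ring, this]
    field_simp
    ring
  have e2 : (a - 1) * (1 / a) = 1 / q := by
    have : 1 / q = 1 - 1 / a := by linarith
    rw [this]
    field_simp
  refine ⟨(4 * B ^ 2 * a / (a - 2) * 2 ^ (a - 2)) ^ (1 / a), by positivity,
    fun T hadd hT2 A hA hT1 f => ?_⟩
  have hN0 : 0 ≤ ∫ y, |f y| ^ q ∂μ := integral_nonneg fun y => by positivity
  rcases hN0.eq_or_lt with hN | hN
  · have hf : f = 0 := by
      rw [eq_comm, integral_eq_zero_iff_of_nonneg (fun y => by positivity)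
        (integrable_abs_rpow f (by linarith) hq2.le)] at hN
      rw [Lp.eq_zero_iff_ae_eq_zero]
      filter_upwards [hN] with y hy
      exact abs_eq_zero.1 ((rpow_eq_zero (abs_nonneg _) (by linarith)).1 hy)
    have hTf : T f = 0 := by
      have := hT2 f
      rw [hf, norm_zero, mul_zero] at this
      rw [hf]
      exact norm_le_zero_iff.1 this
    rw [hTf, eLpNorm_congr_ae (Lp.coeFn_zero ℝ 2 μ), eLpNorm_zero]
    exact zero_le
  rw [eLpNorm_eq_lintegral_ofReal_abs_rpow hp'0 hp't,
    eLpNorm_eq_ofReal_integral_abs_rpow hp0 hp2.le f, ← ENNReal.ofReal_mul (by positivity)]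
  refine (ENNReal.rpow_le_rpow (lintegral_abs_rpow_le hadd hT2 hA hT1 f hq1 hq2.le ha2 hqa hN rfl)
    (by positivity)).trans_eq ?_
  rw [ENNReal.ofReal_rpow_of_nonneg (by positivity) (by positivity), ← ha, ← hq]
  congr 1
  set N := ∫ y, |f y| ^ q ∂μ
  rw [mul_rpow (by positivity) hA.le, ← mul_assoc, mul_rpow (by positivity) (by positivity),
    mul_rpow (by positivity) (by positivity), ← rpow_mul hA.le, ← rpow_mul hN0, e1, e2]

end InterpolationNorm

section Coefficients

open Real

lemma sphMeasure_real_univ {d : ℕ} (hd : 1 ≤ d) :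
    (sphMeasure d).real Set.univ = 2 * π ^ ((d : ℝ) / 2) / Gamma ((d : ℝ) / 2) := by
  have : Nonempty (Fin d) := ⟨⟨0, hd⟩⟩
  have hd0 : (0 : ℝ) < d := by exact_mod_cast hd
  have hG : 0 < Gamma ((d : ℝ) / 2) := Gamma_pos_of_pos (by positivity)
  have hG' : 0 < Gamma ((d : ℝ) / 2 + 1) := Gamma_pos_of_pos (by positivity)
  rw [sphMeasure, Measure.toSphere_real_apply_univ, measureReal_def, EuclideanSpace.volume_ball,
    Fintype.card_fin, ENNReal.ofReal_one, one_pow, one_mul,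
    ENNReal.toReal_ofReal (by positivity), finrank_euclideanSpace_fin,
    Gamma_add_one (by positivity), sqrt_eq_rpow, ← rpow_natCast, ← rpow_mul pi_pos.le]
  rw [show 1 / 2 * (d : ℝ) = d / 2 by ring]
  field_simp

lemma sphMeasure_real_univ_pos {d : ℕ} (hd : 1 ≤ d) : 0 < (sphMeasure d).real Set.univ := by
  have hd0 : (0 : ℝ) < d := by exact_mod_cast hd
  rw [sphMeasure_real_univ hd]
  have hG : 0 < Gamma ((d : ℝ) / 2) := Gamma_pos_of_pos (by positivity)
  positivity

lemma cCoef_eq (r n : ℕ) :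
    cCoef (r + 3) n = (2 * n + (r + 1)) / (r + 1) * ((n + r).choose r : ℝ) /
      (sphMeasure (r + 3)).real Set.univ := by
  have h1 : (n + r : ℝ) + 1 ≠ 0 := by positivity
  have h2 : Gamma ((r + 3 : ℕ) / 2 : ℝ) ≠ 0 := (Gamma_pos_of_pos (by positivity)).ne'
  have h3 := Nat.add_choose_mul_factorial_mul_factorial n r
  have h3' : ((n + r).choose r : ℝ) * n.factorial * r.factorial = (n + r).factorial := by
    exact_mod_cast h3
  rw [sphMeasure_real_univ (by omega), cCoef,
    show ((r + 3 : ℕ) : ℝ) + n - 1 = (n + r + 1 : ℕ) + 1 by push_cast; ring,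
    show ((r + 3 : ℕ) : ℝ) - 1 = (r + 1 : ℕ) + 1 by push_cast; ring,
    Gamma_nat_eq_factorial, Gamma_nat_eq_factorial, Gamma_nat_eq_factorial,
    Nat.factorial_succ, Nat.factorial_succ,
    show ((r + 3 : ℕ) : ℝ) + n - 2 = n + r + 1 by push_cast; ring,
    show ((r + 3 : ℕ) : ℝ) + 2 * n - 2 = 2 * n + (r + 1) by push_cast; ring]
  push_cast
  push_cast at h2
  rw [← h3']
  have := Nat.factorial_ne_zero n
  have := Nat.factorial_ne_zero r
  field_simp

lemma cCoef_pos (r n : ℕ) : 0 < cCoef (r + 3) n := by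
  have := sphMeasure_real_univ_pos (d := r + 3) (by omega)
  have := Nat.choose_pos (Nat.le_add_left r n)
  rw [cCoef_eq]
  positivity

lemma cCoef_mono (r : ℕ) : Monotone (cCoef (r + 3)) := by
  intro n k hnk
  have := sphMeasure_real_univ_pos (d := r + 3) (by omega)
  have h : (n : ℝ) ≤ k := by exact_mod_cast hnk
  have h2 : ((n + r).choose r : ℝ) ≤ (k + r).choose r := by
    exact_mod_cast Nat.choose_le_choose r (by omega)
  rw [cCoef_eq, cCoef_eq]
  gcongr

lemma exists_cCoef_le (r : ℕ) : ∃ C : ℝ, 0 < C ∧ ∀ n : ℕ, 1 ≤ n →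
    cCoef (r + 3) n ≤ C * (n : ℝ) ^ ((r : ℝ) + 1) := by
  have hs := sphMeasure_real_univ_pos (d := r + 3) (by omega)
  refine ⟨(r + 3) ^ (r + 1) / (r + 1) / (sphMeasure (r + 3)).real Set.univ, by positivity,
    fun n hn => ?_⟩
  have hn1 : (1 : ℝ) ≤ n := by exact_mod_cast hn
  have h1 : (2 * n + (r + 1) : ℝ) ≤ (r + 3) * n := by nlinarith [r.cast_nonneg (α := ℝ)]
  have h2 : ((n + r).choose r : ℝ) ≤ ((r + 3) * n) ^ r := by
    refine (show ((n + r).choose r : ℝ) ≤ (n + r : ℝ) ^ r by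
      exact_mod_cast Nat.choose_le_pow (n + r) r).trans ?_
    refine pow_le_pow_left₀ (by positivity) ?_ r
    nlinarith [r.cast_nonneg (α := ℝ)]
  have h3 : (n : ℝ) ^ ((r : ℝ) + 1) = n ^ (r + 1) := by exact_mod_cast rpow_natCast (n : ℝ) (r + 1)
  have h4 : (2 * n + (r + 1) : ℝ) * ((n + r).choose r : ℝ) ≤ ((r + 3) * n) ^ (r + 1) := by
    rw [pow_succ']
    exact mul_le_mul h1 h2 (by positivity) (by positivity)
  rw [cCoef_eq, h3, div_mul_eq_mul_div _ _ ((n + r).choose r : ℝ), div_mul_eq_mul_div,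
    div_mul_eq_mul_div, ← mul_pow]
  gcongr

lemma prod_two_mul_add_mul (r n : ℕ) :
    (∏ k ∈ Finset.range n, (2 * (k : ℝ) + (r + 3 : ℕ))) * (r + 1) =
      (2 * n + (r + 1)) * ∏ k ∈ Finset.range n, (2 * k + (r + 1) : ℝ) := by
  induction n with
  | zero => simp
  | succ n ih =>
    rw [Finset.prod_range_succ, Finset.prod_range_succ, mul_right_comm, ih]
    push_cast
    ring

lemma prod_add_eq_choose (r n : ℕ) :
    ∏ k ∈ Finset.range n, (r + 1 + k : ℝ) = n.factorial * ((n + r).choose r : ℝ) := by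
  have h := Nat.factorial_mul_ascFactorial r n
  rw [Nat.ascFactorial_eq_prod_range, add_comm r n,
    ← Nat.add_choose_mul_factorial_mul_factorial n r] at h
  have h' : (r.factorial : ℝ) * ∏ k ∈ Finset.range n, (r + 1 + k : ℝ) =
      (n + r).choose r * n.factorial * r.factorial := by exact_mod_cast h
  have : (r.factorial : ℝ) ≠ 0 := by exact_mod_cast Nat.factorial_ne_zero r
  refine mul_left_cancel₀ this ?_
  rw [h']
  ring

lemma cCoef_mul_sum_choose_mul_cosMoment (r n : ℕ) :
    cCoef (r + 3) n *
        ((∑ k ∈ Finset.range (n + 1), (n.choose (2 * k) : ℝ) * cosMoment r (2 * k)) *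
          ((sphMeasure (r + 3)).real Set.univ * n.factorial)) =
      ∏ k ∈ Finset.range n, (2 * (k : ℝ) + (r + 3 : ℕ)) := by
  have hs := sphMeasure_real_univ_pos (d := r + 3) (by omega)
  have h1 := prod_two_mul_add_mul r n
  have h2 := sum_choose_mul_cosMoment r n
  rw [prod_add_eq_choose] at h2
  rw [← h2] at h1
  rw [cCoef_eq]
  have hr : (r + 1 : ℝ) ≠ 0 := by positivity
  refine mul_right_cancel₀ hr ?_
  rw [h1]
  field_simp

end Coefficients

section Projection

open MvPolynomial

/-- The reproducing formula for harmonic polynomials on the sphere. -/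
lemma cCoef_mul_sphIntegral_mul_zonalPoly {r n : ℕ} {P : MvPolynomial (Fin (r + 3)) ℝ}
    (hPn : P.IsHomogeneous n) (hP : polyLaplacian P = 0) {y : Fin (r + 3) → ℝ}
    (hy : ∑ i, y i ^ 2 = 1) :
    cCoef (r + 3) n * sphIntegral (P * zonalPoly (fun k => cosMoment r (2 * k)) n y) =
      eval y P := by
  have h := sphIntegral_mul_zonalPoly (by omega) (fun k => cosMoment r (2 * k)) hy hPn hP
  have h2 := cCoef_mul_sum_choose_mul_cosMoment r n
  have hpos : 0 < ∏ k ∈ Finset.range n, (2 * (k : ℝ) + (r + 3 : ℕ)) :=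
    Finset.prod_pos fun k _ => by positivity
  refine mul_right_cancel₀ hpos.ne' ?_
  rw [mul_assoc, h]
  linear_combination eval y P * h2

lemma polyLaplacian_zonalPoly_cosMoment (r n : ℕ) {y : Fin (r + 3) → ℝ}
    (hy : ∑ i, y i ^ 2 = 1) :
    polyLaplacian (zonalPoly (fun k => cosMoment r (2 * k)) n y) = 0 := by
  refine polyLaplacian_zonalPoly (fun k => ?_) n hy
  have h := cosMoment_add_two r (2 * k)
  rw [show 2 * (k + 1) = 2 * k + 2 by ring]
  push_cast at h ⊢
  linear_combination h

lemma exists_polynomial_of_mem_Hspace {d k : ℕ} {g : Lp ℝ 2 (sphMeasure d)} (hg : g ∈ Hspace d k) :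
    ∃ P : MvPolynomial (Fin d) ℝ, P.IsHomogeneous k ∧ polyLaplacian P = 0 ∧
      g =ᵐ[sphMeasure d] fun x => eval (fun i => (x : EuclideanSpace ℝ (Fin d)) i) P := by
  induction hg using Submodule.span_induction with
  | mem g hg =>
    obtain ⟨Y, ⟨P, hPk, hP, hY⟩, hgY⟩ := hg
    exact ⟨P, hPk, hP, hgY.trans (.of_forall hY)⟩
  | zero => exact ⟨0, isHomogeneous_zero _ _ _, by simp [polyLaplacian],
      (Lp.coeFn_zero ℝ 2 _).trans (.of_forall fun x => by simp)⟩
  | add g h _ _ hg hh =>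
    obtain ⟨P, hPk, hP, hgP⟩ := hg
    obtain ⟨Q, hQk, hQ, hhQ⟩ := hh
    refine ⟨P + Q, hPk.add hQk, ?_, ?_⟩
    · simp only [polyLaplacian, map_add, Finset.sum_add_distrib]
      rw [← polyLaplacian, ← polyLaplacian, hP, hQ, add_zero]
    · filter_upwards [Lp.coeFn_add g h, hgP, hhQ] with x hx h1 h2
      rw [hx, Pi.add_apply, h1, h2, map_add]
  | smul a g _ hg =>
    obtain ⟨P, hPk, hP, hgP⟩ := hg
    refine ⟨C a * P, by simpa using (isHomogeneous_C _ a).mul hPk, ?_, ?_⟩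
    · rw [polyLaplacian_C_mul, hP, mul_zero]
    · filter_upwards [Lp.coeFn_smul a g, hgP] with x hx h1
      rw [hx, Pi.smul_apply, h1, map_mul, eval_C, smul_eq_mul]

lemma memLp_eval_sph {d : ℕ} (P : MvPolynomial (Fin d) ℝ) :
    MemLp (fun x : Sph d => eval (fun i => (x : EuclideanSpace ℝ (Fin d)) i) P) 2 (sphMeasure d) :=
  (continuous_eval_sph P).memLp_of_hasCompactSupport (HasCompactSupport.of_compactSpace _)

/-- The class in `L²` of the restriction of a polynomial to the sphere. -/
def sphToLp {d : ℕ} (P : MvPolynomial (Fin d) ℝ) : Lp ℝ 2 (sphMeasure d) :=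
  (memLp_eval_sph P).toLp _

lemma coeFn_sphToLp {d : ℕ} (P : MvPolynomial (Fin d) ℝ) :
    sphToLp P =ᵐ[sphMeasure d] fun x => eval (fun i => (x : EuclideanSpace ℝ (Fin d)) i) P :=
  MemLp.coeFn_toLp _

lemma sphToLp_mem_Hspace {d k : ℕ} {P : MvPolynomial (Fin d) ℝ} (hPk : P.IsHomogeneous k)
    (hP : polyLaplacian P = 0) : sphToLp P ∈ Hspace d k :=
  Submodule.subset_span ⟨_, ⟨P, hPk, hP, fun _ => rfl⟩, coeFn_sphToLp P⟩

lemma eval_zonalPoly_cosMoment (r n : ℕ) (x y : Sph (r + 3)) :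
    eval (fun i => (x : EuclideanSpace ℝ (Fin (r + 3))) i)
      (zonalPoly (fun k => cosMoment r (2 * k)) n
        fun i => (y : EuclideanSpace ℝ (Fin (r + 3))) i) =
      zonalKernel r n (∑ i, (y : EuclideanSpace ℝ (Fin (r + 3))) i *
        (x : EuclideanSpace ℝ (Fin (r + 3))) i) :=
  eval_zonalPoly_sph _ _ _ _

lemma inner_sphToLp_eq_integral {d : ℕ} (f : Lp ℝ 2 (sphMeasure d)) (P : MvPolynomial (Fin d) ℝ) :
    inner ℝ f (sphToLp P) =
      ∫ x, f x * eval (fun i => (x : EuclideanSpace ℝ (Fin d)) i) P ∂sphMeasure d := by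
  rw [L2.inner_def]
  refine integral_congr_ae ?_
  filter_upwards [coeFn_sphToLp P] with x hx
  rw [hx]
  simp [mul_comm]

lemma ae_eq_integral_zonalKernel {r n : ℕ}
    {T : Lp ℝ 2 (sphMeasure (r + 3)) → Lp ℝ 2 (sphMeasure (r + 3))}
    (hT : IsOrthProjOnto (r + 3) n T) (f : Lp ℝ 2 (sphMeasure (r + 3))) :
    ∀ᵐ y ∂sphMeasure (r + 3), T f y = cCoef (r + 3) n * ∫ x, f x *
      zonalKernel r n (∑ i, (y : EuclideanSpace ℝ (Fin (r + 3))) i *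
        (x : EuclideanSpace ℝ (Fin (r + 3))) i) ∂sphMeasure (r + 3) := by
  obtain ⟨hmem, horth⟩ := hT f
  obtain ⟨P, hPn, hP, hTP⟩ := exists_polynomial_of_mem_Hspace hmem
  filter_upwards [hTP] with y hy
  set Z := zonalPoly (fun k => cosMoment r (2 * k)) n
    fun i => (y : EuclideanSpace ℝ (Fin (r + 3))) i with hZ
  have hy1 := sum_sq_sph y
  have hZmem : sphToLp Z ∈ Hspace (r + 3) n :=
    sphToLp_mem_Hspace (isHomogeneous_zonalPoly _ _ _) (polyLaplacian_zonalPoly_cosMoment r n hy1)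
  have h1 : inner ℝ f (sphToLp Z) = inner ℝ (T f) (sphToLp Z) := by
    have := horth _ hZmem
    rwa [inner_sub_left, sub_eq_zero] at this
  rw [inner_sphToLp_eq_integral, inner_sphToLp_eq_integral] at h1
  simp only [hZ, eval_zonalPoly_cosMoment] at h1
  rw [hy, h1, ← cCoef_mul_sphIntegral_mul_zonalPoly hPn hP hy1, sphIntegral]
  congr 1
  refine integral_congr_ae ?_
  filter_upwards [hTP] with x hx
  rw [hx, map_mul, eval_zonalPoly_cosMoment]

lemma IsOrthProjOnto.map_add {d k : ℕ} {T : Lp ℝ 2 (sphMeasure d) → Lp ℝ 2 (sphMeasure d)}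
    (hT : IsOrthProjOnto d k T) (f g : Lp ℝ 2 (sphMeasure d)) : T (f + g) = T f + T g := by
  have hmem : T (f + g) - (T f + T g) ∈ Hspace d k :=
    sub_mem (hT _).1 (add_mem (hT f).1 (hT g).1)
  rw [← sub_eq_zero, ← inner_self_eq_zero (𝕜 := ℝ)]
  have h1 := (hT (f + g)).2 _ hmem
  have h2 := (hT f).2 _ hmem
  have h3 := (hT g).2 _ hmem
  have h4 : T (f + g) - (T f + T g) = (f - T f) + (g - T g) - (f + g - T (f + g)) := by abel
  nth_rewrite 1 [h4]
  rw [inner_sub_left, inner_add_left, h1, h2, h3, add_zero, sub_zero]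

lemma IsOrthProjOnto.norm_le {d k : ℕ} {T : Lp ℝ 2 (sphMeasure d) → Lp ℝ 2 (sphMeasure d)}
    (hT : IsOrthProjOnto d k T) (f : Lp ℝ 2 (sphMeasure d)) : ‖T f‖ ≤ ‖f‖ := by
  have h := (hT f).2 _ (hT f).1
  have h1 : ‖f‖ * ‖f‖ = ‖f - T f‖ * ‖f - T f‖ + ‖T f‖ * ‖T f‖ := by
    rw [← norm_add_sq_eq_norm_sq_add_norm_sq_of_inner_eq_zero _ _ h, sub_add_cancel]
  nlinarith [norm_nonneg f, norm_nonneg (T f), norm_nonneg (f - T f)]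

end Projection

section Conv

open Finset

lemma continuous_zonalKernel (r n : ℕ) : Continuous (zonalKernel r n) := by
  unfold zonalKernel
  fun_prop

lemma integrable_mul_zonalKernel {r : ℕ} (n : ℕ) (f : Lp ℝ 2 (sphMeasure (r + 3)))
    (y : Sph (r + 3)) :
    Integrable (fun x : Sph (r + 3) => f x *
      zonalKernel r n (∑ i, (y : EuclideanSpace ℝ (Fin (r + 3))) i *
        (x : EuclideanSpace ℝ (Fin (r + 3))) i)) (sphMeasure (r + 3)) := by
  have hc : Continuous fun x : Sph (r + 3) =>
      zonalKernel r n (∑ i, (y : EuclideanSpace ℝ (Fin (r + 3))) i *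
        (x : EuclideanSpace ℝ (Fin (r + 3))) i) :=
    (continuous_zonalKernel r n).comp (by fun_prop)
  exact (Lp.memLp f).integrable_mul (q := 2)
    (hc.memLp_of_hasCompactSupport (HasCompactSupport.of_compactSpace _))

lemma sq_sum_mul_sph_le_one {d : ℕ} (x y : Sph d) :
    (∑ i, (y : EuclideanSpace ℝ (Fin d)) i * (x : EuclideanSpace ℝ (Fin d)) i) ^ 2 ≤ 1 := by
  have h := sum_mul_sq_le_sq_mul_sq univ (fun i => (y : EuclideanSpace ℝ (Fin d)) i)
    (fun i => (x : EuclideanSpace ℝ (Fin d)) i)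
  rwa [sum_sq_sph, sum_sq_sph, one_mul] at h

variable {r : ℕ} {proj : ℕ → Lp ℝ 2 (sphMeasure (r + 3)) → Lp ℝ 2 (sphMeasure (r + 3))}

lemma Tconv_add (hproj : ∀ k, IsOrthProjOnto (r + 3) k (proj k)) (n : ℕ)
    (f g : Lp ℝ 2 (sphMeasure (r + 3))) :
    Tconv (r + 3) proj n (f + g) = Tconv (r + 3) proj n f + Tconv (r + 3) proj n g := by
  simp only [Tconv, (hproj _).map_add, smul_add, sum_add_distrib]

lemma norm_Tconv_le (hproj : ∀ k, IsOrthProjOnto (r + 3) k (proj k)) (n : ℕ)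
    (f : Lp ℝ 2 (sphMeasure (r + 3))) : ‖Tconv (r + 3) proj n f‖ ≤ 2 ^ (r + 1) * ‖f‖ := by
  have hsum : ∑ j ∈ range (r + 2), ((r + 1).choose j : ℝ) = 2 ^ (r + 1) := by
    exact_mod_cast Nat.sum_range_choose (r + 1)
  rw [Tconv, ← hsum, sum_mul]
  refine norm_sum_le_of_le _ fun j _ => ?_
  have h1 : |cCoef (r + 3) n / cCoef (r + 3) (n + 2 * j)| ≤ 1 := by
    rw [abs_of_pos (div_pos (cCoef_pos r n) (cCoef_pos r _)), div_le_one (cCoef_pos r _)]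
    exact cCoef_mono r (Nat.le_add_right _ _)
  rw [norm_smul, norm_mul, norm_mul, norm_pow, norm_neg, norm_one, one_pow, one_mul,
    Real.norm_natCast, Real.norm_eq_abs]
  exact mul_le_mul (mul_le_of_le_one_right (Nat.cast_nonneg _) h1) ((hproj _).norm_le f)
    (norm_nonneg _) (Nat.cast_nonneg _)

lemma ae_Tconv_eq_integral_diffKernel (hproj : ∀ k, IsOrthProjOnto (r + 3) k (proj k)) (n : ℕ)
    (f : Lp ℝ 2 (sphMeasure (r + 3))) :
    ∀ᵐ y ∂sphMeasure (r + 3), Tconv (r + 3) proj n f y = cCoef (r + 3) n * ∫ x, f x *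
      diffKernel r n (∑ i, (y : EuclideanSpace ℝ (Fin (r + 3))) i *
        (x : EuclideanSpace ℝ (Fin (r + 3))) i) ∂sphMeasure (r + 3) := by
  have h1 := ae_all_iff.2 fun j : ℕ => ae_eq_integral_zonalKernel (hproj (n + 2 * j)) f
  have h2 := ae_all_iff.2 fun j : ℕ => Lp.coeFn_smul
    ((-1 : ℝ) ^ j * ((r + 1).choose j : ℝ) * (cCoef (r + 3) n / cCoef (r + 3) (n + 2 * j)))
    (proj (n + 2 * j) f)
  have h3 := Lp.coeFn_fun_finsetSum (range (r + 2)) fun j : ℕ =>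
    ((-1 : ℝ) ^ j * ((r + 1).choose j : ℝ) * (cCoef (r + 3) n / cCoef (r + 3) (n + 2 * j))) •
      proj (n + 2 * j) f
  filter_upwards [h1, h2, h3] with y h1 h2 h3
  have hint : ∀ j ∈ range (r + 2), Integrable (fun x : Sph (r + 3) =>
      ((-1 : ℝ) ^ j * ((r + 1).choose j : ℝ)) * (f x *
        zonalKernel r (n + 2 * j) (∑ i, (y : EuclideanSpace ℝ (Fin (r + 3))) i *
          (x : EuclideanSpace ℝ (Fin (r + 3))) i))) (sphMeasure (r + 3)) := fun j _ =>
    (integrable_mul_zonalKernel (n + 2 * j) f y).const_mul _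
  have h4 : ∀ x : Sph (r + 3), f x *
      diffKernel r n (∑ i, (y : EuclideanSpace ℝ (Fin (r + 3))) i *
        (x : EuclideanSpace ℝ (Fin (r + 3))) i) =
      ∑ j ∈ range (r + 2), ((-1 : ℝ) ^ j * ((r + 1).choose j : ℝ)) * (f x *
        zonalKernel r (n + 2 * j) (∑ i, (y : EuclideanSpace ℝ (Fin (r + 3))) i *
          (x : EuclideanSpace ℝ (Fin (r + 3))) i)) := fun x => by
    rw [diffKernel, mul_sum]
    exact sum_congr rfl fun j _ => by ring
  refine h3.trans ?_
  simp only [h4]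
  rw [integral_finsetSum _ hint, mul_sum]
  refine sum_congr rfl fun j _ => ?_
  rw [h2, Pi.smul_apply, h1, smul_eq_mul, integral_const_mul]
  have := (cCoef_pos r (n + 2 * j)).ne'
  field_simp

theorem exists_abs_Tconv_le (r : ℕ) : ∃ C : ℝ, 0 < C ∧
    ∀ proj : ℕ → Lp ℝ 2 (sphMeasure (r + 3)) → Lp ℝ 2 (sphMeasure (r + 3)),
      (∀ k, IsOrthProjOnto (r + 3) k (proj k)) → ∀ n : ℕ, 1 ≤ n →
        ∀ f : Lp ℝ 2 (sphMeasure (r + 3)), ∀ᵐ y ∂sphMeasure (r + 3),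
          |Tconv (r + 3) proj n f y| ≤
            C * (n : ℝ) ^ (((r : ℝ) + 1) / 2) * ∫ x, |f x| ∂sphMeasure (r + 3) := by
  obtain ⟨C₁, hC₁, hK⟩ := exists_abs_diffKernel_le r
  obtain ⟨C₂, hC₂, hc⟩ := exists_cCoef_le r
  refine ⟨C₂ * C₁, mul_pos hC₂ hC₁, fun proj hproj n hn f => ?_⟩
  have hn0 : (0 : ℝ) < n := by exact_mod_cast hn
  filter_upwards [ae_Tconv_eq_integral_diffKernel hproj n f] with y hy
  have hf : Integrable (fun x => |f x|) (sphMeasure (r + 3)) :=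
    ((Lp.memLp f).integrable one_le_two).abs
  have h1 : |∫ x, f x * diffKernel r n (∑ i, (y : EuclideanSpace ℝ (Fin (r + 3))) i *
        (x : EuclideanSpace ℝ (Fin (r + 3))) i) ∂sphMeasure (r + 3)| ≤
      ∫ x, C₁ * (n : ℝ) ^ (-((r : ℝ) + 1) / 2) * |f x| ∂sphMeasure (r + 3) := by
    rw [← Real.norm_eq_abs]
    refine norm_integral_le_of_norm_le (hf.const_mul _) (.of_forall fun x => ?_)
    rw [norm_mul, mul_comm]
    exact mul_le_mul_of_nonneg_right (hK n hn _ (sq_sum_mul_sph_le_one x y)) (abs_nonneg _)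
  rw [integral_const_mul] at h1
  have h2 : (n : ℝ) ^ ((r : ℝ) + 1) * (n : ℝ) ^ (-((r : ℝ) + 1) / 2) =
      (n : ℝ) ^ (((r : ℝ) + 1) / 2) := by
    rw [← Real.rpow_add hn0]
    ring_nf
  rw [hy, abs_mul, abs_of_pos (cCoef_pos r n), ← h2]
  refine (mul_le_mul (hc n hn) h1 (abs_nonneg _) (by positivity)).trans_eq ?_
  ring

end Conv

/-- Estimate (2.5-0): if `1 ≤ p ≤ 2` with conjugate exponent `p'`, then
`‖T_n f‖_{p'} ≤ C n^{(d-2)(1/p - 1/2)} ‖f‖_p` for all `f ∈ L²(S^{d-1}, σ)`. -/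
theorem Tconv_bound_conjugate
    (d : ℕ) (hd : 3 ≤ d) (p p' : ℝ≥0∞)
    (hp1 : 1 ≤ p) (hp2 : p ≤ 2) (hpp' : 1 / p + 1 / p' = 1)
    (proj : ℕ → Lp ℝ 2 (sphMeasure d) → Lp ℝ 2 (sphMeasure d))
    (hproj : ∀ k, IsOrthProjOnto d k (proj k)) :
    ∃ C : ℝ, 0 < C ∧ ∀ n : ℕ, 1 ≤ n → ∀ f : Lp ℝ 2 (sphMeasure d),
      eLpNorm (⇑(Tconv d proj n f)) p' (sphMeasure d) ≤
        ENNReal.ofReal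
            (C * (n : ℝ) ^ (((d : ℝ) - 2) * (1 / p.toReal - 1 / 2))) *
          eLpNorm (⇑f) p (sphMeasure d) := by
  obtain ⟨r, rfl⟩ := Nat.exists_eq_add_of_le' hd
  obtain ⟨C₀, hC₀, hT⟩ := exists_abs_Tconv_le r
  obtain ⟨C, hC, h⟩ := exists_eLpNorm_conjugate_le (sphMeasure (r + 3)) hp1 hp2 hpp'
    (B := 2 ^ (r + 1)) (by positivity)
  refine ⟨C * C₀ ^ (2 / p.toReal - 1), by positivity, fun n hn f => ?_⟩
  have hn0 : (0 : ℝ) < n := by exact_mod_cast hn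
  have h1 := h (Tconv (r + 3) proj n) (Tconv_add hproj n) (norm_Tconv_le hproj n)
    (C₀ * (n : ℝ) ^ (((r : ℝ) + 1) / 2)) (by positivity) (hT proj hproj n hn) f
  have h2 : (((r + 3 : ℕ) : ℝ) - 2) * (1 / p.toReal - 1 / 2) =
      ((r : ℝ) + 1) / 2 * (2 / p.toReal - 1) := by
    push_cast
    ring
  rwa [Real.mul_rpow hC₀.le (by positivity), ← Real.rpow_mul hn0.le, ← h2, ← mul_assoc] at h1
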